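/- Let TT ⊆ ℝ³ be the truncated tetrahedron given as the convex hull of the 12 points obtained by taking all coordinate permutations of (1,1,3) and applying to each the sign patterns (+,+,+), (+,−,−), (−,+,−), (−,−,+). Then every translative packing of TT has upper density at most 0.7293. -/

import Mathlib

open MeasureTheory Filter Metric

/-- A translative packing of `K`: a set of translation vectors such that the translates
of the interior of `K` are pairwise disjoint. -/
def IsTranslativePacking (K X : Set (EuclideanSpace ℝ (Fin 3))) : Prop :=
  ∀ x ∈ X, ∀ y ∈ X, x ≠ y →
    Disjoint ((fun z => x + z) '' interior K) ((fun z => y + z) '' interior K)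

/-- The upper density of a translative packing `X` of the body `K`. -/
noncomputable def packingUpperDensity (K X : Set (EuclideanSpace ℝ (Fin 3))) : ℝ :=
  Filter.limsup (fun r : ℝ => ⨆ c : EuclideanSpace ℝ (Fin 3),
    (volume (closedBall c r ∩ ⋃ x ∈ X, (fun z => x + z) '' K) /
      volume (closedBall c r)).toReal) Filter.atTop

namespace TTP

/-- homogeneous Horner evaluation -/
def H1 {R : Type} [CommSemiring R] (Z W : R) : ℕ → List ℕ → R
  | _, [] => 0
  | 0, x :: _ => (x : R)
  | j + 1, x :: xs => (x : R) * W ^ (j + 1) + Z * H1 Z W j xs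

def H2 {R : Type} [CommSemiring R] (Y Z W : R) : ℕ → List (List ℕ) → R
  | _, [] => 0
  | 0, x :: _ => H1 Z W 0 x
  | j + 1, x :: xs => H1 Z W (j + 1) x + Y * H2 Y Z W j xs

def H3 {R : Type} [CommSemiring R] (X Y Z W : R) : ℕ → List (List (List ℕ)) → R
  | _, [] => 0
  | 0, x :: _ => H2 Y Z W 0 x
  | j + 1, x :: xs => H2 Y Z W (j + 1) x + X * H3 X Y Z W j xs

/-- vectors `(x, y, z, w)` and radial vectors `(σ, θ)` -/
structure V4 where
  x : ℕ
  y : ℕ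
  z : ℕ
  w : ℕ

def V4.add (u v : V4) : V4 := ⟨u.x + v.x, u.y + v.y, u.z + v.z, u.w + v.w⟩

structure Cell where
  u : V4
  v : V4
  w : V4
  s : ℕ × ℕ
  t : ℕ × ℕ

/-- evaluation of the form on the cell at `a, b, c, α, β` -/
def Cell.form {R : Type} [CommSemiring R] (e : ℕ) (C : Cell) (T : List (List (List ℕ)))
    (a b c α β : R) : R :=
  H3 (((C.u.x : R) * a + (C.v.x : R) * b + (C.w.x : R) * c) ^ e * ((C.s.1 : R) * α + (C.t.1 : R) * β))
    (((C.u.y : R) * a + (C.v.y : R) * b + (C.w.y : R) * c) ^ e * ((C.s.1 : R) * α + (C.t.1 : R) * β))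
    (((C.u.z : R) * a + (C.v.z : R) * b + (C.w.z : R) * c) ^ e * ((C.s.1 : R) * α + (C.t.1 : R) * β))
    (((C.u.w : R) * a + (C.v.w : R) * b + (C.w.w : R) * c) ^ e * ((C.s.2 : R) * α + (C.t.2 : R) * β))
    9 T

/-- compare digits -/
def cmp (chk : ℕ → ℕ → Bool) (b : ℕ) : ℕ → ℕ → ℕ → Bool
  | 0, _, M => Nat.beq M 0
  | n + 1, N, M => chk (N % b) (M % b) && cmp chk b n (N / b) (M / b)

structure Bases where
  e : ℕ
  n1 : ℕ
  n2 : ℕ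
  n3 : ℕ
  b1 : ℕ
  b2 : ℕ
  b3 : ℕ

def leafOK (B : Bases) (P M : List (List (List ℕ))) (C : Cell) : Bool :=
  Nat.blt (C.form B.e P 1 B.b2 1 B.b3 1) B.b1 && Nat.blt (C.form B.e M 1 B.b2 1 B.b3 1) B.b1 &&
  (Nat.blt (C.form B.e P 1 1 1 B.b3 1) B.b2 && Nat.blt (C.form B.e M 1 1 1 B.b3 1) B.b2) &&
  (Nat.blt (C.form B.e P 1 1 1 1 1) B.b3 && Nat.blt (C.form B.e M 1 1 1 1 1) B.b3) &&
  cmp (cmp (cmp (fun x y => Nat.ble y x) B.b3 B.n3) B.b2 B.n2) B.b1 B.n1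
    (C.form B.e P B.b1 B.b2 1 B.b3 1) (C.form B.e M B.b1 B.b2 1 B.b3 1)

inductive STree where
  | l : STree
  | a : STree → STree → STree
  | b : STree → STree → STree
  | c : STree → STree → STree
  | r : STree → STree → STree

def check (B : Bases) (P M : List (List (List ℕ))) : STree → Cell → Bool
  | .l, C => leafOK B P M C
  | .a T U, C => check B P M T {C with v := C.u.add C.v} && check B P M U {C with u := C.u.add C.v}
  | .b T U, C => check B P M T {C with w := C.u.add C.w} && check B P M U {C with u := C.u.add C.w}
  | .c T U, C => check B P M T {C with w := C.v.add C.w} && check B P M U {C with v := C.v.add C.w}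
  | .r T U, C => check B P M T {C with t := (C.s.1 + C.t.1, C.s.2 + C.t.2)} &&
      check B P M U {C with s := (C.s.1 + C.t.1, C.s.2 + C.t.2)}

def mp3 (f : ℤ → ℕ) (T : List (List (List ℤ))) : List (List (List ℕ)) :=
  T.map (fun l => l.map (fun m => m.map f))

structure Op (α : Type) where
  add : α → α → α
  zero : α
  smul : ℤ → α → α

def intOp : Op ℤ := ⟨fun x y => x + y, 0, fun x y => x * y⟩

/-- ragged addition of lists -/
def ladd {α : Type} (add : α → α → α) : List α → List α → List α
  | [], m => m
  | x :: xs, [] => x :: xs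
  | x :: xs, y :: ys => add x y :: ladd add xs ys

def listOp {α : Type} (o : Op α) : Op (List α) :=
  ⟨ladd o.add, [], fun k l => l.map (o.smul k)⟩

/-- `∑ l_k • G_k`, with running `G_k = g1`, `G_{k-1} = g0` -/
def hT {α : Type} (o : Op α) : ℤ → List ℤ → List ℤ → List α → List α
  | _, _, _, [] => []
  | k, g0, g1, x :: xs => ladd o.add (g1.map (fun c => o.smul c x))
      (hT o (k + 1) g1
        (ladd (fun a b => a + b) (ladd (fun a b => a + b) (g1.map (fun c => (4 * k + 1) * c))
          (0 :: g1.map (fun c => -c))) (g0.map (fun c => -(2 * k * (2 * k - 1)) * c))) xs)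

def hT' {α : Type} (o : Op α) (l : List α) : List α := hT o 0 [] [1] l

def hT3 (l : List (List (List ℤ))) : List (List (List ℤ)) :=
  (hT' (listOp (listOp intOp)) l).map (fun m => (hT' (listOp intOp) m).map (hT' intOp))



def qT : List (List (List ℤ)) :=
  [[[2000000000000,611708467770,-45152655438,12701366194,-2124770948,357417862,-25961653,957687,-34506,817],[611708467770,-253298527717,31947428555,-18992107219,2682455425,-252773053,13032187,-235866,-342],[-45152655438,31947428555,-33963489396,8564840405,-1145807462,106127690,-5630914,117456],[12701366194,-18992107219,8564840405,-1545151993,195399029,-10411607,185126],[-2124770948,2682455425,-1145807462,195399029,-15778981,386312],[357417862,-252773053,106127690,-10411607,386312],[-25961653,13032187,-5630914,185126],[957687,-235866,117456],[-34506,-342],[817]],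
  [[611708467770,-253298527717,31947428555,-18992107219,2682455425,-252773053,13032187,-235866,-342],[-253298527717,134781381266,-54812978449,15798288621,-2082325871,183026963,-7222279,77356],[31947428555,-54812978449,12279789725,-1198811724,138444908,-9641987,269195],[-18992107219,15798288621,-1198811724,-312586792,42666226,-1400994],[2682455425,-2082325871,138444908,42666226,-820312],[-252773053,183026963,-9641987,-1400994],[13032187,-7222279,269195],[-235866,77356],[-342]],
  [[-45152655438,31947428555,-33963489396,8564840405,-1145807462,106127690,-5630914,117456],[31947428555,-54812978449,12279789725,-1198811724,138444908,-9641987,269195],[-33963489396,12279789725,746934479,65894755,-58896354,2130785],[8564840405,-1198811724,65894755,-18871647,432103],[-1145807462,138444908,-58896354,432103],[106127690,-9641987,2130785],[-5630914,269195],[117456]],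
  [[12701366194,-18992107219,8564840405,-1545151993,195399029,-10411607,185126],[-18992107219,15798288621,-1198811724,-312586792,42666226,-1400994],[8564840405,-1198811724,65894755,-18871647,432103],[-1545151993,-312586792,-18871647,5475942],[195399029,42666226,432103],[-10411607,-1400994],[185126]],
  [[-2124770948,2682455425,-1145807462,195399029,-15778981,386312],[2682455425,-2082325871,138444908,42666226,-820312],[-1145807462,138444908,-58896354,432103],[195399029,42666226,432103],[-15778981,-820312],[386312]],
  [[357417862,-252773053,106127690,-10411607,386312],[-252773053,183026963,-9641987,-1400994],[106127690,-9641987,2130785],[-10411607,-1400994],[386312]],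
  [[-25961653,13032187,-5630914,185126],[13032187,-7222279,269195],[-5630914,269195],[185126]],
  [[957687,-235866,117456],[-235866,77356],[117456]],
  [[-34506,-342],[-342]],
  [[817]]]

def tree0 : STree :=
  (.r (.r .l .l) (.b (.b .l .l) .l))

def cell0 : Cell :=
  ⟨⟨3, 0, 0, 1⟩, ⟨3, 1, 0, 1⟩, ⟨6, 1, 1, 2⟩, (1, 0), (1, 1)⟩

def tree1 : STree :=
  (.r (.r (.r .l .l) .l) .l)

def cell1 : Cell :=
  ⟨⟨3, 1, 0, 1⟩, ⟨6, 1, 1, 2⟩, ⟨2, 2, 0, 1⟩, (1, 0), (1, 1)⟩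

def tree2 : STree :=
  (.r (.r (.r .l (.b (.b .l (.a (.b .l .l) .l)) (.a .l .l))) (.r (.b .l .l) (.c (.r .l (.c (.c (.r .l .l) .l) .l)) .l))) (.b .l (.c .l .l)))

def cell2 : Cell :=
  ⟨⟨6, 1, 1, 2⟩, ⟨2, 2, 0, 1⟩, ⟨4, 4, 4, 3⟩, (1, 0), (1, 1)⟩

def tree3 : STree :=
  (.r (.r (.r (.b (.a (.r (.r (.r .l (.r (.c .l .l) (.a (.b (.r .l (.r .l (.a (.a (.r .l (.c .l .l)) .l) .l))) .l) .l))) (.a (.b .l .l) .l)) (.a .l .l)) (.r .l .l)) (.c .l .l)) (.b (.a .l .l) .l)) (.b (.r (.a .l (.a .l .l)) (.a .l (.r (.r (.a .l .l) (.a .l (.a .l .l))) (.r (.a .l (.a .l (.a .l .l))) .l)))) (.r .l (.r .l (.r .l .l))))) .l)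

def cell3 : Cell :=
  ⟨⟨4, 0, 0, 1⟩, ⟨4, 4, 0, 1⟩, ⟨4, 4, 4, 1⟩, (1, 0), (0, 1)⟩

def pT : List (List (List ℤ)) := hT3 qT

def base0 : Bases := ⟨2, 19, 19, 10, 2 ^ 22420, 2 ^ 1180, 2 ^ 118⟩
def base2 : Bases := ⟨2, 19, 19, 10, 2 ^ 28700, 2 ^ 1510, 2 ^ 151⟩
def base3 : Bases := ⟨1, 10, 10, 10, 2 ^ 11500, 2 ^ 1150, 2 ^ 115⟩

def pN : List (List (List ℕ)) := mp3 (fun x => (-x).toNat) pT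
def pP : List (List (List ℕ)) := mp3 (fun x => x.toNat) pT
def qN : List (List (List ℕ)) := mp3 (fun x => (-x).toNat) qT
def qP : List (List (List ℕ)) := mp3 (fun x => x.toNat) qT



section sound

open Polynomial

lemma H1_map {R S : Type} [CommSemiring R] [CommSemiring S] (f : R →+* S) (Z W : R) (l : List ℕ) :
    ∀ j, f (H1 Z W j l) = H1 (f Z) (f W) j l := by
  induction l with
  | nil => intro j; cases j <;> simp [H1]
  | cons x xs ih => intro j; cases j <;> simp [H1, ih]

lemma H2_map {R S : Type} [CommSemiring R] [CommSemiring S] (f : R →+* S) (Y Z W : R)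
    (l : List (List ℕ)) : ∀ j, f (H2 Y Z W j l) = H2 (f Y) (f Z) (f W) j l := by
  induction l with
  | nil => intro j; cases j <;> simp [H2]
  | cons x xs ih => intro j; cases j <;> simp [H2, ih, H1_map]

lemma H3_map {R S : Type} [CommSemiring R] [CommSemiring S] (f : R →+* S) (X Y Z W : R)
    (l : List (List (List ℕ))) : ∀ j, f (H3 X Y Z W j l) = H3 (f X) (f Y) (f Z) (f W) j l := by
  induction l with
  | nil => intro j; cases j <;> simp [H3]
  | cons x xs ih => intro j; cases j <;> simp [H3, ih, H2_map]

lemma form_map {R S : Type} [CommSemiring R] [CommSemiring S] (f : R →+* S) (e : ℕ) (C : Cell)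
    (T : List (List (List ℕ))) (a b c α β : R) :
    f (C.form e T a b c α β) = C.form e T (f a) (f b) (f c) (f α) (f β) := by
  simp [Cell.form, H3_map]

lemma H1_hom (s Z W : ℝ) (l : List ℕ) : ∀ j, H1 (s * Z) (s * W) j l = s ^ j * H1 Z W j l := by
  induction l with
  | nil => intro j; cases j <;> simp [H1]
  | cons x xs ih => intro j; cases j <;> simp [H1, ih]; ring

lemma H2_hom (s Y Z W : ℝ) (l : List (List ℕ)) :
    ∀ j, H2 (s * Y) (s * Z) (s * W) j l = s ^ j * H2 Y Z W j l := by
  induction l with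
  | nil => intro j; cases j <;> simp [H2]
  | cons x xs ih => intro j; cases j <;> simp [H2, ih, H1_hom]; ring

lemma H3_hom (s X Y Z W : ℝ) (l : List (List (List ℕ))) :
    ∀ j, H3 (s * X) (s * Y) (s * Z) (s * W) j l = s ^ j * H3 X Y Z W j l := by
  induction l with
  | nil => intro j; cases j <;> simp [H3]
  | cons x xs ih => intro j; cases j <;> simp [H3, ih, H2_hom]; ring

lemma H1_cont (Z W : ℝ → ℝ) (hZ : Continuous Z) (hW : Continuous W) (l : List ℕ) :
    ∀ j, Continuous fun t => H1 (Z t) (W t) j l := by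
  induction l with
  | nil => intro j; cases j <;> simp only [H1] <;> fun_prop
  | cons x xs ih => intro j; cases j with
    | zero => simp only [H1]; fun_prop
    | succ j => have := ih j; simp only [H1]; fun_prop

lemma H2_cont (Y Z W : ℝ → ℝ) (hY : Continuous Y) (hZ : Continuous Z) (hW : Continuous W)
    (l : List (List ℕ)) : ∀ j, Continuous fun t => H2 (Y t) (Z t) (W t) j l := by
  induction l with
  | nil => intro j; cases j <;> simp only [H2] <;> fun_prop
  | cons x xs ih => intro j; cases j with
    | zero => simp only [H2]; exact H1_cont Z W hZ hW x 0
    | succ j => have := ih j; have h1 := H1_cont Z W hZ hW x (j + 1); simp only [H2]; fun_prop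

lemma H3_cont (X Y Z W : ℝ → ℝ) (hX : Continuous X) (hY : Continuous Y) (hZ : Continuous Z)
    (hW : Continuous W)
    (l : List (List (List ℕ))) : ∀ j, Continuous fun t => H3 (X t) (Y t) (Z t) (W t) j l := by
  induction l with
  | nil => intro j; cases j <;> simp only [H3] <;> fun_prop
  | cons x xs ih => intro j; cases j with
    | zero => simp only [H3]; exact H2_cont Y Z W hY hZ hW x 0
    | succ j => have := ih j; have h1 := H2_cont Y Z W hY hZ hW x (j + 1); simp only [H3]; fun_prop

lemma form_hom (e : ℕ) (C : Cell) (T : List (List (List ℕ))) (a b c α β s t : ℝ) :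
    C.form e T (s * a) (s * b) (s * c) (t * α) (t * β) = (s ^ e * t) ^ 9 * C.form e T a b c α β := by
  unfold Cell.form
  rw [← H3_hom]
  congr 1 <;> (conv_rhs => rw [mul_mul_mul_comm, ← mul_pow]) <;> ring_nf

lemma form_cont (e : ℕ) (C : Cell) (T : List (List (List ℕ))) (a b c α β : ℝ) :
    Continuous fun t : ℝ => C.form e T a b (c + t) α (β + t) := by
  unfold Cell.form
  apply H3_cont <;> fun_prop

lemma coeff_le_eval {S : Type} [CommSemiring S] (k : S →+* ℕ) (p : S[X]) (i : ℕ) :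
    k (p.coeff i) ≤ eval₂ k 1 p := by
  by_cases h : i ∈ p.support
  · rw [eval₂_eq_sum, Polynomial.sum]
    simp only [one_pow, mul_one]
    exact Finset.single_le_sum (f := fun i => k (p.coeff i)) (fun _ _ => Nat.zero_le _) h
  · rw [notMem_support_iff.1 h]; simp

lemma eval_zero_coeff (p : ℕ[X]) (b : ℕ) (hb : 0 < b) (h : p.eval b = 0) (i : ℕ) :
    p.coeff i = 0 := by
  by_contra hi
  have hs : i ∈ p.support := mem_support_iff.2 hi
  rw [eval_eq_sum, Polynomial.sum] at h
  have := (Finset.sum_eq_zero_iff.1 h) i hs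
  have hp : 0 < b ^ i := pow_pos hb i
  rcases Nat.mul_eq_zero.1 this with h | h
  · exact hi h
  · omega

lemma cmp_sound (chk : ℕ → ℕ → Bool) (b : ℕ) : ∀ (n : ℕ) (p r : ℕ[X]), p.eval 1 < b → r.eval 1 < b →
    cmp chk b n (p.eval b) (r.eval b) = true →
    ∀ i, chk (p.coeff i) (r.coeff i) = true ∨ r.coeff i = 0 := by
  intro n
  induction n with
  | zero =>
    intro p r hp hr h i
    right
    simp only [cmp] at h
    exact eval_zero_coeff r b (by omega) (Nat.eq_of_beq_eq_true h) i
  | succ n ih =>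
    have key : ∀ p : ℕ[X], p.eval 1 < b → p.eval b % b = p.coeff 0 ∧ p.eval b / b = p.divX.eval b ∧
        p.divX.eval 1 < b := by
      intro p hp
      have e0 := congrArg (eval b) (divX_mul_X_add p)
      have e1 := congrArg (eval 1) (divX_mul_X_add p)
      simp only [eval_add, eval_mul, eval_X, eval_C, mul_one] at e0 e1
      have h0 : p.coeff 0 < b := by omega
      refine ⟨?_, ?_, by omega⟩
      · rw [← e0, Nat.add_mod, Nat.mul_mod_left, zero_add, Nat.mod_mod, Nat.mod_eq_of_lt h0]
      · rw [← e0, Nat.add_div_of_dvd_right (Dvd.intro_left _ rfl), Nat.mul_div_cancel _ (by omega),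
          Nat.div_eq_of_lt h0, add_zero]
    intro p r hp hr h i
    obtain ⟨p1, p2, p3⟩ := key p hp
    obtain ⟨r1, r2, r3⟩ := key r hr
    simp only [cmp, Bool.and_eq_true] at h
    rw [p1, r1, p2, r2] at h
    cases i with
    | zero => exact Or.inl h.1
    | succ i =>
      have := ih p.divX r.divX p3 r3 h.2 i
      simpa [coeff_divX] using this

structure Sound (S : Type) [CommSemiring S] (bd : S → Prop) (k : S →+* ℕ) (v : S →+* ℝ)
    (chk : ℕ → ℕ → Bool) : Prop where
  main : ∀ p r, bd p → bd r → chk (k p) (k r) = true → v r ≤ v p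
  zero : ∀ r, k r = 0 → v r = 0
  nonneg : ∀ r, 0 ≤ v r

lemma Sound.step {S : Type} [CommSemiring S] {bd : S → Prop} {k : S →+* ℕ} {v : S →+* ℝ}
    {chk : ℕ → ℕ → Bool} (h : Sound S bd k v chk) (b n : ℕ) (hb : 0 < b) (x : ℝ) (hx : 0 ≤ x) :
    Sound S[X] (fun p => (∀ i, bd (p.coeff i)) ∧ eval₂ k 1 p < b) (eval₂RingHom k b)
      (eval₂RingHom v x) (cmp chk b n) := by
  have hn : ∀ r : S[X], 0 ≤ eval₂ v x r := by
    intro r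
    rw [eval₂_eq_sum, Polynomial.sum]
    exact Finset.sum_nonneg fun i _ => mul_nonneg (h.nonneg _) (pow_nonneg hx _)
  refine ⟨?_, ?_, hn⟩
  · intro p r hp hr hc
    have hc' := cmp_sound chk b n (p.map k) (r.map k) (by simpa [eval_map] using hp.2)
      (by simpa [eval_map] using hr.2) (by simpa [eval_map] using hc)
    simp only [coe_eval₂RingHom]
    set N := max p.natDegree r.natDegree + 1
    rw [eval₂_eq_sum_range' v (n := N) (by omega), eval₂_eq_sum_range' v (n := N) (by omega)]
    refine Finset.sum_le_sum fun i _ => mul_le_mul_of_nonneg_right ?_ (pow_nonneg hx _)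
    rcases hc' i with h1 | h1
    · rw [coeff_map, coeff_map] at h1
      exact h.main _ _ (hp.1 i) (hr.1 i) h1
    · rw [coeff_map] at h1
      rw [h.zero _ h1]; exact h.nonneg _
  · intro r hr
    simp only [coe_eval₂RingHom] at hr ⊢
    have := eval_zero_coeff (r.map k) b hb (by simpa [eval_map] using hr)
    rw [eval₂_eq_sum, Polynomial.sum]
    refine Finset.sum_eq_zero fun i _ => ?_
    have h2 := this i
    rw [coeff_map] at h2
    rw [h.zero _ h2, zero_mul]

lemma sound0 : Sound ℕ (fun _ => True) (RingHom.id ℕ) (Nat.castRingHom ℝ) (fun x y => Nat.ble y x) where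
  main p r _ _ h := by
    have := Nat.le_of_ble_eq_true h
    simpa using this
  zero r h := by simpa using h
  nonneg r := by simp

abbrev PS (S : Type) [CommSemiring S] : Type := S[X]

lemma leaf_sound1 (B : Bases) (P M : List (List (List ℕ))) (C : Cell) (h : leafOK B P M C = true)
    (a b ρ : ℝ) (ha : 0 ≤ a) (hb : 0 ≤ b) (hρ : 0 ≤ ρ) :
    C.form B.e M a b 1 ρ 1 ≤ C.form B.e P a b 1 ρ 1 := by
  unfold leafOK at h
  simp only [Bool.and_eq_true] at h
  obtain ⟨⟨⟨⟨h1, h2⟩, h3, h4⟩, h5, h6⟩, h7⟩ := h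
  have lt : ∀ x y, Nat.blt x y = true → x < y := fun x y h => by
    have := Nat.le_of_ble_eq_true h; omega
  replace h1 := lt _ _ h1; replace h2 := lt _ _ h2; replace h3 := lt _ _ h3
  replace h4 := lt _ _ h4; replace h5 := lt _ _ h5; replace h6 := lt _ _ h6
  have S1 := sound0.step B.b3 B.n3 (by omega) ρ hρ
  have S2 := S1.step B.b2 B.n2 (by omega) b hb
  have S3 := S2.step B.b1 B.n1 (by omega) a ha
  let F : List (List (List ℕ)) → PS (PS (PS ℕ)) := fun T => C.form B.e T X (Polynomial.C X) 1 (Polynomial.C (Polynomial.C X)) 1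
  let k3 : ℕ → ℕ[X] →+* ℕ := fun c => eval₂RingHom (RingHom.id ℕ) c
  let k2 : ℕ → ℕ → PS (PS ℕ) →+* ℕ := fun b c => eval₂RingHom (k3 c) b
  let k1 : ℕ → ℕ → ℕ → PS (PS (PS ℕ)) →+* ℕ := fun a b c => eval₂RingHom (k2 b c) a
  have ev : ∀ T a b c, k1 a b c (F T) = C.form B.e T a b 1 c 1 := by
    intro T a b c
    rw [form_map]
    simp [k1, k2, k3]
  have bd : ∀ T, C.form B.e T 1 B.b2 1 B.b3 1 < B.b1 → C.form B.e T 1 1 1 B.b3 1 < B.b2 →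
      C.form B.e T 1 1 1 1 1 < B.b3 → 
      (∀ i, (∀ j, (∀ _ : ℕ, True) ∧ eval₂ (RingHom.id ℕ) 1 (((F T).coeff i).coeff j) < B.b3) ∧
        eval₂ (k3 B.b3) 1 ((F T).coeff i) < B.b2) ∧ eval₂ (k2 B.b2 B.b3) 1 (F T) < B.b1 := by
    intro T e1 e2 e3
    rw [← ev] at e1 e2 e3
    refine ⟨fun i => ⟨fun j => ⟨fun _ => trivial, ?_⟩, ?_⟩, e1⟩
    · refine lt_of_le_of_lt ?_ e3
      exact (coeff_le_eval (k3 1) ((F T).coeff i) j).trans (coeff_le_eval (k2 1 1) (F T) i)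
    · refine lt_of_le_of_lt ?_ e2
      exact (coeff_le_eval (k2 1 B.b3) (F T) i)
  have := S3.main (F P) (F M) (bd P h1 h3 h5) (bd M h2 h4 h6) (by
    have e1 := ev P B.b1 B.b2 B.b3
    have e2 := ev M B.b1 B.b2 B.b3
    simp only [k1, k2, k3] at e1 e2
    rw [e1, e2]
    exact h7)
  simp only [F] at this
  rw [form_map, form_map] at this
  simpa using this

lemma leaf_sound2 (B : Bases) (P M : List (List (List ℕ))) (C : Cell) (h : leafOK B P M C = true)
    (a b c α β : ℝ) (ha : 0 ≤ a) (hb : 0 ≤ b) (hc : 0 < c) (hα : 0 ≤ α) (hβ : 0 < β) :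
    C.form B.e M a b c α β ≤ C.form B.e P a b c α β := by
  have h1 := leaf_sound1 B P M C h (a / c) (b / c) (α / β) (by positivity) (by positivity)
    (by positivity)
  have key : ∀ T, C.form B.e T a b c α β = (c ^ B.e * β) ^ 9 * C.form B.e T (a / c) (b / c) 1 (α / β) 1 := by
    intro T
    rw [← form_hom]
    congr 1 <;> field_simp
  rw [key, key]
  exact mul_le_mul_of_nonneg_left h1 (by positivity)

lemma leaf_sound (B : Bases) (P M : List (List (List ℕ))) (C : Cell) (h : leafOK B P M C = true)
    (a b c α β : ℝ) (ha : 0 ≤ a) (hb : 0 ≤ b) (hc : 0 ≤ c) (hα : 0 ≤ α) (hβ : 0 ≤ β) :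
    C.form B.e M a b c α β ≤ C.form B.e P a b c α β := by
  have h1 := (form_cont B.e C M a b c α β).continuousWithinAt (s := Set.Ioi 0) (x := 0)
  have h2 := (form_cont B.e C P a b c α β).continuousWithinAt (s := Set.Ioi 0) (x := 0)
  have := le_of_tendsto_of_tendsto h1 h2 (by
    filter_upwards [self_mem_nhdsWithin] with t ht
    have ht : 0 < t := ht
    exact leaf_sound2 B P M C h a b (c + t) α (β + t) ha hb (by linarith) hα (by linarith))
  simpa using this

lemma check_sound (B : Bases) (P M : List (List (List ℕ))) (T : STree) : ∀ (C : Cell),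
    check B P M T C = true → ∀ a b c α β : ℝ, 0 ≤ a → 0 ≤ b → 0 ≤ c → 0 ≤ α → 0 ≤ β →
    C.form B.e M a b c α β ≤ C.form B.e P a b c α β := by
  induction T with
  | l => intro C h a b c α β; exact leaf_sound B P M C h a b c α β
  | a T U hT hU =>
    intro C h a b c α β ha hb hc hα hβ
    simp only [check, Bool.and_eq_true] at h
    rcases le_total b a with hab | hab
    · have := hT _ h.1 (a - b) b c α β (by linarith) hb hc hα hβ
      unfold Cell.form at this ⊢; simp only [V4.add] at this
      push_cast at this
      convert this using 3 <;> ring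
    · have := hU _ h.2 a (b - a) c α β ha (by linarith) hc hα hβ
      unfold Cell.form at this ⊢; simp only [V4.add] at this
      push_cast at this
      convert this using 3 <;> ring
  | b T U hT hU =>
    intro C h a b c α β ha hb hc hα hβ
    simp only [check, Bool.and_eq_true] at h
    rcases le_total c a with hab | hab
    · have := hT _ h.1 (a - c) b c α β (by linarith) hb hc hα hβ
      unfold Cell.form at this ⊢; simp only [V4.add] at this
      push_cast at this
      convert this using 3 <;> ring
    · have := hU _ h.2 a b (c - a) α β ha hb (by linarith) hα hβ
      unfold Cell.form at this ⊢; simp only [V4.add] at this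
      push_cast at this
      convert this using 3 <;> ring
  | c T U hT hU =>
    intro C h a b c α β ha hb hc hα hβ
    simp only [check, Bool.and_eq_true] at h
    rcases le_total c b with hab | hab
    · have := hT _ h.1 a (b - c) c α β ha (by linarith) hc hα hβ
      unfold Cell.form at this ⊢; simp only [V4.add] at this
      push_cast at this
      convert this using 3 <;> ring
    · have := hU _ h.2 a b (c - b) α β ha hb (by linarith) hα hβ
      unfold Cell.form at this ⊢; simp only [V4.add] at this
      push_cast at this
      convert this using 3 <;> ring
  | r T U hT hU =>
    intro C h a b c α β ha hb hc hα hβ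
    simp only [check, Bool.and_eq_true] at h
    rcases le_total β α with hab | hab
    · have := hT _ h.1 a b c (α - β) β ha hb hc (by linarith) hβ
      unfold Cell.form at this ⊢
      push_cast at this
      convert this using 3 <;> ring
    · have := hU _ h.2 a b c α (β - α) ha hb hc hα (by linarith)
      unfold Cell.form at this ⊢
      push_cast at this
      convert this using 3 <;> ring

end sound



lemma chk0 : check base0 pN pP tree0 cell0 = true := by decide +kernel
lemma chk1 : check base0 pN pP tree1 cell1 = true := by decide +kernel
lemma chk2 : check base2 pN pP tree2 cell2 = true := by decide +kernel
lemma chk3 : check base3 qP qN tree3 cell3 = true := by decide +kernel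



section evals

def pev {α : Type} (e : α → ℝ) (u : ℝ) : List α → ℝ
  | [] => 0
  | x :: xs => e x + u * pev e u xs

def ok1 (j : ℕ) (l : List ℕ) : Bool := Nat.ble l.length (j + 1)

def ok2 : ℕ → List (List ℕ) → Bool
  | _, [] => true
  | 0, x :: xs => ok1 0 x && xs.isEmpty
  | j + 1, x :: xs => ok1 (j + 1) x && ok2 j xs

def ok3 : ℕ → List (List (List ℕ)) → Bool
  | _, [] => true
  | 0, x :: xs => ok2 0 x && xs.isEmpty
  | j + 1, x :: xs => ok2 (j + 1) x && ok3 j xs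

lemma H1_pev (W z : ℝ) (l : List ℕ) : ∀ j, ok1 j l = true →
    H1 (W * z) W j l = W ^ j * pev (fun n : ℕ => (n : ℝ)) z l := by
  induction l with
  | nil => intro j _; cases j <;> simp [H1, pev]
  | cons x xs ih =>
    intro j h
    have h := Nat.le_of_ble_eq_true h
    simp only [List.length_cons] at h
    cases j with
    | zero =>
      have : xs = [] := List.length_eq_zero_iff.1 (by omega)
      subst this; simp [H1, pev]
    | succ j =>
      simp only [H1, pev]
      rw [ih j (Nat.ble_eq_true_of_le (by omega))]; ring

lemma H2_pev (W y z : ℝ) (l : List (List ℕ)) : ∀ j, ok2 j l = true →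
    H2 (W * y) (W * z) W j l = W ^ j * pev (pev (fun n : ℕ => (n : ℝ)) z) y l := by
  induction l with
  | nil => intro j _; cases j <;> simp [H2, pev]
  | cons x xs ih =>
    intro j h
    cases j with
    | zero =>
      simp only [ok2, Bool.and_eq_true, List.isEmpty_iff] at h
      obtain ⟨h, rfl⟩ := h
      simp only [H2, pev, H1_pev W z x 0 h]; ring
    | succ j =>
      simp only [ok2, Bool.and_eq_true] at h
      simp only [H2, pev, H1_pev W z x _ h.1, ih j h.2]; ring

lemma H3_pev (W x' y z : ℝ) (l : List (List (List ℕ))) : ∀ j, ok3 j l = true →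
    H3 (W * x') (W * y) (W * z) W j l = W ^ j * pev (pev (pev (fun n : ℕ => (n : ℝ)) z) y) x' l := by
  induction l with
  | nil => intro j _; cases j <;> simp [H3, pev]
  | cons x xs ih =>
    intro j h
    cases j with
    | zero =>
      simp only [ok3, Bool.and_eq_true, List.isEmpty_iff] at h
      obtain ⟨h, rfl⟩ := h
      simp only [H3, pev, H2_pev W y z x 0 h]; ring
    | succ j =>
      simp only [ok3, Bool.and_eq_true] at h
      simp only [H3, pev, H2_pev W y z x _ h.1, ih j h.2]; ring

def ev3 (T : List (List (List ℤ))) (x y z : ℝ) : ℝ := pev (pev (pev (fun n : ℤ => (n : ℝ)) z) y) x T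

lemma pev_sub {α β : Type} (e : α → ℝ) (e' : β → ℝ) (f g : α → β)
    (h : ∀ x, e x = e' (f x) - e' (g x)) (u : ℝ) (l : List α) :
    pev e u l = pev e' u (l.map f) - pev e' u (l.map g) := by
  induction l with
  | nil => simp [pev]
  | cons x xs ih => simp only [pev, List.map_cons, ih, h x]; ring

lemma ev3_split (T : List (List (List ℤ))) (x y z : ℝ) :
    ev3 T x y z = pev (pev (pev (fun n : ℕ => (n : ℝ)) z) y) x (mp3 (fun x => x.toNat) T) -
      pev (pev (pev (fun n : ℕ => (n : ℝ)) z) y) x (mp3 (fun x => (-x).toNat) T) := by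
  unfold ev3 mp3
  refine pev_sub _ _ _ _ (fun l => pev_sub _ _ _ _ (fun l => pev_sub _ _ _ _ (fun n => ?_) _ _) _ _) _ _
  rcases le_total 0 n with h | h
  · have h1 : (-n).toNat = 0 := by omega
    have h2 : ((n.toNat : ℤ) : ℝ) = n := by rw [Int.toNat_of_nonneg h]
    rw [h1]; push_cast at h2; rw [h2]; simp
  · have h1 : (n).toNat = 0 := by omega
    have h2 : (((-n).toNat : ℤ) : ℝ) = -n := by rw [Int.toNat_of_nonneg (by omega)]; push_cast; rfl
    rw [h1]; push_cast at h2; rw [h2]; simp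

lemma okP : (ok3 9 pN && ok3 9 pP && ok3 9 qN && ok3 9 qP) = true := by decide +kernel

lemma ev3_nonneg_of (T : List (List (List ℤ))) (W x y z : ℝ) (hW : 0 < W)
    (h1 : ok3 9 (mp3 (fun x => x.toNat) T) = true) (h2 : ok3 9 (mp3 (fun x => (-x).toNat) T) = true)
    (h : H3 (W * x) (W * y) (W * z) W 9 (mp3 (fun x => (-x).toNat) T) ≤
      H3 (W * x) (W * y) (W * z) W 9 (mp3 (fun x => x.toNat) T)) : 0 ≤ ev3 T x y z := by
  rw [H3_pev _ _ _ _ _ _ h1, H3_pev _ _ _ _ _ _ h2] at h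
  rw [ev3_split]
  have := le_of_mul_le_mul_left h (by positivity)
  linarith

lemma ev3_nonpos_of (T : List (List (List ℤ))) (W x y z : ℝ) (hW : 0 < W)
    (h1 : ok3 9 (mp3 (fun x => x.toNat) T) = true) (h2 : ok3 9 (mp3 (fun x => (-x).toNat) T) = true)
    (h : H3 (W * x) (W * y) (W * z) W 9 (mp3 (fun x => x.toNat) T) ≤
      H3 (W * x) (W * y) (W * z) W 9 (mp3 (fun x => (-x).toNat) T)) : ev3 T x y z ≤ 0 := by
  rw [H3_pev _ _ _ _ _ _ h1, H3_pev _ _ _ _ _ _ h2] at h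
  rw [ev3_split]
  have := le_of_mul_le_mul_left h (by positivity)
  linarith

lemma P_sorted (x y z : ℝ) (hz : 0 ≤ z) (hyz : z ≤ y) (hxy : y ≤ x) (h : 4 ≤ x + y + z ∨ 3 ≤ x) :
    ev3 pT (x ^ 2) (y ^ 2) (z ^ 2) ≤ 0 := by
  have ok := okP
  simp only [Bool.and_eq_true] at ok
  obtain ⟨⟨⟨o1, o2⟩, -⟩, -⟩ := ok
  rcases le_total (3 * (y + z)) x with h1 | h1
  · have hW : 1 ≤ x / 3 := by rcases h with h | h <;> linarith
    refine ev3_nonpos_of pT ((x / 3) ^ 2) _ _ _ (by positivity) o2 o1 ?_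
    have := check_sound _ _ _ _ _ chk0 (x / 3 - y - z) (y - z) z ((x / 3) ^ 2 - 1) 1 (by linarith)
      (by linarith) hz (by nlinarith) zero_le_one
    unfold Cell.form at this
    simp only [cell0, base0] at this
    push_cast at this
    convert this using 2 <;> first | ring1 | rfl
  · have hW : 1 ≤ (x + y + z) / 4 := by rcases h with h | h <;> linarith
    refine ev3_nonpos_of pT (((x + y + z) / 4) ^ 2) _ _ _ (by positivity) o2 o1 ?_
    rcases le_total (5 * z) (x - y) with h2 | h2
    · have := check_sound _ _ _ _ _ chk1 ((x - y - 5 * z) / 2) z ((3 * y + 3 * z - x) / 4)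
        (((x + y + z) / 4) ^ 2 - 1) 1 (by linarith)
        (by linarith) (by linarith) (by nlinarith) zero_le_one
      unfold Cell.form at this
      simp only [cell1, base0] at this
      push_cast at this
      convert this using 2 <;> first | ring1 | rfl
    · have := check_sound _ _ _ _ _ chk2 ((x - y) / 5) ((y - z) / 2) ((z - (x - y) / 5) / 4)
        (((x + y + z) / 4) ^ 2 - 1) 1 (by linarith)
        (by linarith) (by linarith) (by nlinarith) zero_le_one
      unfold Cell.form at this
      simp only [cell2, base2] at this
      push_cast at this
      convert this using 2 <;> first | ring1 | rfl

lemma pev_zero {α : Type} (e : α → ℝ) (d : α) (hd : e d = 0) (l : List α) : pev e 0 l = e (l.headD d) := by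
  cases l <;> simp [pev, hd]

lemma ev3_zero (T : List (List (List ℤ))) :
    ev3 T 0 0 0 = (((T.headD []).headD []).headD 0 : ℤ) := by
  unfold ev3
  rw [pev_zero _ [] rfl, pev_zero _ [] rfl, pev_zero _ 0 (by simp)]

lemma pT_zero : ev3 pT 0 0 0 = 2994189595258 := by
  rw [ev3_zero]
  have : ((pT.headD []).headD []).headD 0 = 2994189595258 := by decide +kernel
  rw [this]; norm_num

lemma Q_sorted (x y z : ℝ) (hz : 0 ≤ z) (hyz : z ≤ y) (hxy : y ≤ x) : 0 ≤ ev3 qT x y z := by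
  have ok := okP
  simp only [Bool.and_eq_true] at ok
  obtain ⟨⟨-, o1⟩, o2⟩ := ok
  rcases eq_or_lt_of_le (hz.trans (hyz.trans hxy)) with h | h
  · obtain rfl : z = 0 := by linarith
    obtain rfl : y = 0 := by linarith
    rw [← h, ev3_zero]
    simp [qT]
  · refine ev3_nonneg_of qT (x / 4) _ _ _ (by positivity) o2 o1 ?_
    have := check_sound _ _ _ _ _ chk3 ((x - y) / 4) ((y - z) / 4) (z / 4) (x / 4) 1 (by linarith)
      (by linarith) (by linarith) (by linarith) zero_le_one
    unfold Cell.form at this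
    simp only [cell3, base3] at this
    push_cast at this
    convert this using 2 <;> first | ring1 | rfl

end evals


section herm

noncomputable def G : ℕ → ℝ → ℝ
  | 0, _ => 1
  | 1, t => 1 - t
  | k + 2, t => (4 * (k + 1 : ℝ) + 1 - t) * G (k + 1) t - 2 * (k + 1) * (2 * (k + 1) - 1) * G k t

def gev {α : Type} (e : α → ℝ) (A : ℕ → ℝ) : ℕ → List α → ℝ
  | _, [] => 0
  | k, x :: xs => A k * e x + gev e A (k + 1) xs

structure Resp {α : Type} (o : Op α) (e : α → ℝ) : Prop where
  add : ∀ x y, e (o.add x y) = e x + e y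
  smul : ∀ (c : ℤ) x, e (o.smul c x) = c * e x

lemma gev_resp {α : Type} {o : Op α} {e : α → ℝ} (h : Resp o e) (A : ℕ → ℝ) (k : ℕ) :
    Resp (listOp o) (gev e A k) := by
  constructor
  · intro x
    induction x generalizing k with
    | nil => intro y; simp [listOp, ladd, gev]
    | cons x xs ih =>
      intro y
      cases y with
      | nil => simp [listOp, ladd, gev]
      | cons y ys =>
        have := ih (k + 1) ys
        simp only [listOp] at this
        simp only [listOp, ladd, gev, this, h.add]; ring
  · intro c x
    induction x generalizing k with
    | nil => simp [listOp, gev]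
    | cons x xs ih =>
      have := ih (k + 1)
      simp only [listOp] at this
      simp only [listOp, List.map_cons, gev, this, h.smul]; ring

lemma int_resp : Resp intOp (fun n : ℤ => (n : ℝ)) := by
  constructor <;> intros <;> simp [intOp]

lemma pev_ladd {α : Type} (ad : α → α → α) (e : α → ℝ) (h : ∀ x y, e (ad x y) = e x + e y) (u : ℝ)
    (l : List α) : ∀ m, pev e u (ladd ad l m) = pev e u l + pev e u m := by
  induction l with
  | nil => intro m; simp [ladd, pev]
  | cons x xs ih =>
    intro m
    cases m with
    | nil => simp [ladd, pev]
    | cons y ys => simp only [ladd, pev, ih, h]; ring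

lemma pev_mul {α β : Type} (e : α → ℝ) (e' : β → ℝ) (f : α → β) (c u : ℝ)
    (h : ∀ x, e' (f x) = c * e x) (l : List α) : pev e' u (l.map f) = c * pev e u l := by
  induction l with
  | nil => simp [pev]
  | cons x xs ih => simp only [List.map_cons, pev, h, ih]; ring

lemma pev_pow {α : Type} (e : α → ℝ) (u : ℝ) (l : List α) : ∀ k, 
    gev e (fun i => u ^ i) k l = u ^ k * pev e u l := by
  induction l with
  | nil => intro k; simp [pev, gev]
  | cons x xs ih => intro k; simp only [gev, pev, ih]; ring

lemma hT_sound {α : Type} {o : Op α} {e : α → ℝ} (h : Resp o e) (u : ℝ) (l : List α) :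
    ∀ (k : ℕ) (g0 g1 : List ℤ), pev (fun n : ℤ => (n : ℝ)) u g1 = G k u →
    (k = 0 ∨ pev (fun n : ℤ => (n : ℝ)) u g0 = G (k - 1) u) →
    pev e u (hT o k g0 g1 l) = gev e (fun k => G k u) k l := by
  induction l with
  | nil => intros; simp [hT, pev, gev]
  | cons x xs ih =>
    intro k g0 g1 h1 h0
    simp only [hT, gev]
    rw [pev_ladd _ _ h.add]
    have e1 : pev e u (g1.map (fun c => o.smul c x)) = e x * G k u := by
      rw [← h1]
      exact pev_mul _ _ _ _ _ (fun c => by rw [h.smul]; ring) _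
    rw [e1, mul_comm]
    congr 1
    have := ih (k + 1) g1 (ladd (fun a b => a + b) (ladd (fun a b => a + b) (g1.map (fun c => (4 * (k : ℤ) + 1) * c))
          (0 :: g1.map (fun c => -c))) (g0.map (fun c => -(2 * (k : ℤ) * (2 * k - 1)) * c))) ?_
          (Or.inr h1)
    · rw [← this]; push_cast; rfl
    · rw [pev_ladd _ _ (by simp), pev_ladd _ _ (by simp)]
      simp only [pev]
      rw [pev_mul (fun n : ℤ => (n : ℝ)) (fun n : ℤ => (n : ℝ)) _ (4 * (k : ℝ) + 1) u (by simp),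
        pev_mul (fun n : ℤ => (n : ℝ)) (fun n : ℤ => (n : ℝ)) _ (-1) u (by simp),
        pev_mul (fun n : ℤ => (n : ℝ)) (fun n : ℤ => (n : ℝ)) _ (-(2 * (k : ℝ) * (2 * k - 1))) u (by simp), h1]
      cases k with
      | zero => simp [G]; ring
      | succ k =>
        rcases h0 with h0 | h0
        · omega
        · rw [h0]; simp only [Nat.add_sub_cancel, G]; push_cast; ring

lemma hT'_sound {α : Type} {o : Op α} {e : α → ℝ} (h : Resp o e) (u : ℝ) (l : List α) :
    pev e u (hT' o l) = gev e (fun k => G k u) 0 l := by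
  have := hT_sound h u l 0 [] [1] (by simp [pev, G]) (Or.inl rfl)
  exact this

def g3 (T : List (List (List ℤ))) (A B C : ℕ → ℝ) : ℝ :=
  gev (gev (gev (fun n : ℤ => (n : ℝ)) C 0) B 0) A 0 T

lemma pev_map {α β : Type} (e : β → ℝ) (f : α → β) (u : ℝ) (l : List α) :
    pev e u (l.map f) = pev (fun x => e (f x)) u l := by
  induction l with
  | nil => simp [pev]
  | cons x xs ih => simp only [List.map_cons, pev, ih]

lemma ev3_hT3 (T : List (List (List ℤ))) (x y z : ℝ) :
    ev3 (hT3 T) x y z = g3 T (fun k => G k x) (fun k => G k y) (fun k => G k z) := by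
  unfold ev3 hT3 g3
  rw [pev_map]
  simp only [pev_map]
  simp only [hT'_sound int_resp]
  have r1 := gev_resp int_resp (fun k => G k z) 0
  have := fun m => hT'_sound r1 y m
  simp only [this]
  exact hT'_sound (gev_resp r1 _ 0) x T

lemma ev3_pow (T : List (List (List ℤ))) (x y z : ℝ) :
    ev3 T x y z = g3 T (fun k => x ^ k) (fun k => y ^ k) (fun k => z ^ k) := by
  unfold ev3 g3
  have h : ∀ {α : Type} (e : α → ℝ) (u : ℝ), gev e (fun i => u ^ i) 0 = pev e u := by
    intro α e u; funext l; rw [pev_pow]; simp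
  rw [h, h, h]

def qc (i j k : ℕ) : ℤ := ((qT.getD i []).getD j []).getD k 0

lemma gev_sum {α : Type} (e : α → ℝ) (A : ℕ → ℝ) (d : α) (hd : e d = 0) (l : List α) :
    ∀ k n, l.length ≤ n → gev e A k l = ∑ i ∈ Finset.range n, A (k + i) * e (l.getD i d) := by
  induction l with
  | nil => intro k n _; simp [gev, hd]
  | cons x xs ih =>
    intro k n hn
    cases n with
    | zero => simp at hn
    | succ n =>
      simp only [List.length_cons] at hn
      rw [Finset.sum_range_succ', gev, ih (k + 1) n (by omega)]
      simp only [List.getD_cons_zero, List.getD_cons_succ, add_zero]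
      rw [add_comm]
      congr 1
      refine Finset.sum_congr rfl fun i _ => ?_
      rw [show k + 1 + i = k + (i + 1) by ring]

noncomputable def S3 (A B C : ℕ → ℝ) : ℝ := ∑ i ∈ Finset.range 10, ∑ j ∈ Finset.range 10, ∑ k ∈ Finset.range 10,
  (qc i j k : ℝ) * (A i * B j * C k)

lemma qT_shape : ∀ i < 10, (qT.getD i []).length ≤ 10 ∧ ∀ j < 10, ((qT.getD i []).getD j []).length ≤ 10 := by
  decide +kernel

lemma g3_sum (A B C : ℕ → ℝ) : g3 qT A B C = S3 A B C := by
  unfold g3 S3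
  rw [gev_sum _ _ [] (by simp [gev]) _ _ 10 (by simp [qT])]
  refine Finset.sum_congr rfl fun i hi => ?_
  have hs := qT_shape i (Finset.mem_range.1 hi)
  rw [gev_sum _ _ [] (by simp [gev]) _ _ 10 hs.1, Finset.mul_sum]
  refine Finset.sum_congr rfl fun j hj => ?_
  have hs := hs.2 j (Finset.mem_range.1 hj)
  rw [gev_sum _ _ 0 (by simp) _ _ 10 hs, Finset.mul_sum, Finset.mul_sum]
  refine Finset.sum_congr rfl fun k hk => ?_
  simp only [qc, zero_add]; ring

lemma qc_sym : ∀ i < 10, ∀ j < 10, ∀ k < 10, qc i j k = qc j i k ∧ qc i j k = qc i k j := by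
  decide +kernel

lemma S3_sym12 (A B C : ℕ → ℝ) : S3 A B C = S3 B A C := by
  unfold S3
  rw [Finset.sum_comm]
  refine Finset.sum_congr rfl fun i hi => Finset.sum_congr rfl fun j hj => Finset.sum_congr rfl fun k hk => ?_
  rw [(qc_sym i (Finset.mem_range.1 hi) j (Finset.mem_range.1 hj) k (Finset.mem_range.1 hk)).1]; ring

lemma S3_sym23 (A B C : ℕ → ℝ) : S3 A B C = S3 A C B := by
  unfold S3
  refine Finset.sum_congr rfl fun i hi => ?_
  rw [Finset.sum_comm]
  refine Finset.sum_congr rfl fun j hj => Finset.sum_congr rfl fun k hk => ?_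
  rw [(qc_sym i (Finset.mem_range.1 hi) j (Finset.mem_range.1 hj) k (Finset.mem_range.1 hk)).2]; ring

noncomputable def Pf (x y z : ℝ) : ℝ := S3 (fun k => G k (x ^ 2)) (fun k => G k (y ^ 2)) (fun k => G k (z ^ 2))
noncomputable def Qf (x y z : ℝ) : ℝ := S3 (fun k => x ^ k) (fun k => y ^ k) (fun k => z ^ k)

lemma Pf_zero : Pf 0 0 0 = 2994189595258 := by
  rw [← pT_zero, pT, ev3_hT3, g3_sum, Pf]; norm_num

lemma qc_zero : qc 0 0 0 = 2000000000000 := by decide +kernel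

/-- sorting principle -/
lemma sort3 (p : ℝ → ℝ → ℝ → Prop) (h12 : ∀ x y z, p x y z → p y x z) (h23 : ∀ x y z, p x y z → p x z y)
    (h : ∀ x y z, z ≤ y → y ≤ x → p x y z) (x y z : ℝ) : p x y z := by
  rcases le_total x y with a | a <;> rcases le_total y z with b | b <;> rcases le_total x z with c | c
  · exact h23 _ _ _ (h12 _ _ _ (h23 _ _ _ (h _ _ _ a b)))
  · exact h23 _ _ _ (h12 _ _ _ (h23 _ _ _ (h _ _ _ a b)))
  · exact h12 _ _ _ (h23 _ _ _ (h _ _ _ c b))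
  · exact h12 _ _ _ (h _ _ _ c a)
  · exact h23 _ _ _ (h12 _ _ _ (h _ _ _ a c))
  · exact h23 _ _ _ (h _ _ _ b c)
  · exact h _ _ _ b a
  · exact h _ _ _ b a

lemma Qf_nonneg (x y z : ℝ) : 0 ≤ x → 0 ≤ y → 0 ≤ z → 0 ≤ Qf x y z := by
  refine sort3 (fun x y z => 0 ≤ x → 0 ≤ y → 0 ≤ z → 0 ≤ Qf x y z) ?_ ?_ ?_ x y z
  · intro x y z h a b c; rw [Qf, S3_sym12]; exact h b a c
  · intro x y z h a b c; rw [Qf, S3_sym23]; exact h a c b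
  · intro x y z h1 h2 hx hy hz
    have := Q_sorted x y z hz h1 h2
    rwa [ev3_pow, g3_sum] at this

lemma Pf_nonpos' (x y z : ℝ) : 0 ≤ x → 0 ≤ y → 0 ≤ z → (4 ≤ x + y + z ∨ 3 ≤ x ∨ 3 ≤ y ∨ 3 ≤ z) → Pf x y z ≤ 0 := by
  refine sort3 (fun x y z => 0 ≤ x → 0 ≤ y → 0 ≤ z → (4 ≤ x + y + z ∨ 3 ≤ x ∨ 3 ≤ y ∨ 3 ≤ z) → Pf x y z ≤ 0) ?_ ?_ ?_ x y z
  · intro x y z h a b c d; rw [Pf, S3_sym12]; exact h b a c (by rw [add_comm x y]; tauto)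
  · intro x y z h a b c d; rw [Pf, S3_sym23]; exact h a c b (by rw [add_right_comm]; tauto)
  · intro x y z h1 h2 hx hy hz h
    have := P_sorted x y z hz h1 h2 (by
      rcases h with h | h | h | h
      · exact Or.inl h
      all_goals exact Or.inr (by linarith))
    rwa [pT, ev3_hT3, g3_sum] at this

lemma Pf_nonpos (x y z : ℝ) (h : 4 ≤ |x| + |y| + |z| ∨ 3 ≤ |x| ∨ 3 ≤ |y| ∨ 3 ≤ |z|) : Pf x y z ≤ 0 := by
  have := Pf_nonpos' |x| |y| |z| (abs_nonneg _) (abs_nonneg _) (abs_nonneg _) h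
  simpa [Pf, sq_abs] using this

end herm


section oned

open ProbabilityTheory

noncomputable abbrev g1 : Measure ℝ := gaussianReal 0 1

noncomputable def cg (t : ℝ) : ℂ := Complex.exp (-(t : ℂ) ^ 2 / 2)

noncomputable def DD (n : ℕ) : ℝ → ℂ := iteratedDeriv n cg

lemma cg_smooth : ContDiff ℝ ⊤ cg := by
  unfold cg
  have : ContDiff ℝ ⊤ (fun t : ℝ => (t : ℂ)) := Complex.ofRealCLM.contDiff
  fun_prop

lemma DD_deriv (n : ℕ) (t : ℝ) : HasDerivAt (DD n) (DD (n + 1) t) t := by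
  have h : Differentiable ℝ (DD n) := cg_smooth.differentiable_iteratedDeriv n (by exact_mod_cast WithTop.coe_lt_top _)
  have := (h t).hasDerivAt
  have e : DD (n + 1) t = deriv (DD n) t := by rw [DD, iteratedDeriv_succ]; rfl
  rw [e]
  exact this

lemma DD_zero (t : ℝ) : DD 0 t = cg t := by simp [DD]

lemma DD_one (t : ℝ) : DD 1 t = -t * cg t := by
  have h1 := DD_deriv 0 t
  have h2 : HasDerivAt (DD 0) (-t * cg t) t := by
    have e : DD 0 = cg := by funext t; exact DD_zero t
    rw [e]
    unfold cg
    have h3 : HasDerivAt (fun t : ℝ => (t : ℂ)) 1 t := Complex.ofRealCLM.hasDerivAt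
    have := (((h3.pow 2).neg).div_const 2).cexp
    refine this.congr_deriv ?_
    have e : (-(fun t : ℝ => (t : ℂ)) ^ 2) t = -(t : ℂ) ^ 2 := rfl
    rw [e]; push_cast; simp; ring
  exact h1.unique h2

lemma DD_rec (n : ℕ) : ∀ t : ℝ, DD (n + 2) t = -t * DD (n + 1) t - (n + 1) * DD n t := by
  have h3 : ∀ t : ℝ, HasDerivAt (fun t : ℝ => (t : ℂ)) 1 t := fun t => Complex.ofRealCLM.hasDerivAt
  induction n with
  | zero =>
    intro t
    have h1 := DD_deriv 1 t
    have e : DD 1 = fun t : ℝ => -t * DD 0 t := by funext t; rw [DD_one, DD_zero]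
    have h2 := ((h3 t).neg.mul (DD_deriv 0 t))
    have h4 := h2.congr_of_eventuallyEq (f₁ := DD 1) (Eventually.of_forall (fun t => congrFun e t))
    rw [h1.unique h4]; push_cast; simp; ring
  | succ n ih =>
    intro t
    have h1 := DD_deriv (n + 2) t
    have e : DD (n + 2) = fun t : ℝ => -t * DD (n + 1) t - (n + 1) * DD n t := by funext t; rw [ih]
    have h2 := ((h3 t).neg.mul (DD_deriv (n + 1) t)).sub ((DD_deriv n t).const_mul ((n : ℂ) + 1))
    have h4 := h2.congr_of_eventuallyEq (f₁ := DD (n + 2)) (Eventually.of_forall (fun t => congrFun e t))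
    rw [h1.unique h4]; push_cast; simp; ring

lemma DD_even (k : ℕ) (t : ℝ) : DD (2 * k) t = (-1) ^ k * (G k (t ^ 2) : ℂ) * cg t ∧
    DD (2 * (k + 1)) t = (-1) ^ (k + 1) * (G (k + 1) (t ^ 2) : ℂ) * cg t := by
  induction k with
  | zero =>
    refine ⟨by simp [DD_zero, G], ?_⟩
    have := DD_rec 0 t
    simp only [zero_add] at this
    rw [show 2 * (0 + 1) = 2 by rfl, this, DD_one, DD_zero]; simp [G]; ring
  | succ k ih =>
    refine ⟨ih.2, ?_⟩
    have e1 := DD_rec (2 * k) t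
    have e2 := DD_rec (2 * k + 1) t
    have e3 := DD_rec (2 * k + 2) t
    rw [show 2 * (k + 1 + 1) = 2 * k + 2 + 2 by ring, e3]
    obtain ⟨i1, i2⟩ := ih
    rw [show 2 * (k + 1) = 2 * k + 2 by ring] at i2
    have e4 : (-t : ℂ) * DD (2 * k + 1) t = DD (2 * k + 2) t + (2 * k + 1) * DD (2 * k) t := by
      rw [e1]; push_cast; ring
    have e5 : DD (2 * k + 2 + 1) t = -t * DD (2 * k + 2) t - (2 * k + 2) * DD (2 * k + 1) t := by
      rw [show 2 * k + 2 + 1 = 2 * k + 1 + 2 by ring, e2]; push_cast; ring_nf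
    have e6 : (-t : ℂ) * DD (2 * k + 2 + 1) t = t ^ 2 * DD (2 * k + 2) t - (2 * k + 2) *
       (DD (2 * k + 2) t + (2 * k + 1) * DD (2 * k) t) := by
      rw [e5, ← e4]; ring
    rw [e6, i1, i2]
    simp only [G]; push_cast; ring

lemma charFun_g1 : charFun g1 = cg := by
  funext t
  rw [charFun_gaussianReal, cg]; congr 1; simp; ring

/-- even moments against a character -/
lemma moment_exp (k : ℕ) (t : ℝ) :
    ∫ x : ℝ, ((x ^ 2) ^ k : ℂ) * Complex.exp (t * x * Complex.I) ∂g1 = (G k (t ^ 2) : ℂ) * cg t := by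
  have h := iteratedDeriv_charFun (μ := g1) (n := 2 * k) (t := t) (by
    have := memLp_id_gaussianReal (μ := 0) (v := 1) ((2 * k : ℕ) : NNReal)
    exact_mod_cast this)
  rw [charFun_g1] at h
  have h2 := (DD_even k t).1
  rw [DD, h, pow_mul Complex.I, Complex.I_sq, mul_assoc] at h2
  have := mul_left_cancel₀ (by simp) h2
  rw [← this]
  simp_rw [pow_mul]

lemma integrable_mom (k : ℕ) : Integrable (fun x : ℝ => (x ^ 2) ^ k) g1 := by
  have := memLp_id_gaussianReal (μ := 0) (v := 1) ((2 * k : ℕ) : NNReal)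
  have := this.integrable_norm_pow' 
  simp only [id] at this
  convert this using 2 with x
  simp [pow_mul]

lemma integrable_mom_exp (k : ℕ) (t : ℝ) :
    Integrable (fun x : ℝ => ((x ^ 2) ^ k : ℂ) * Complex.exp (t * x * Complex.I)) g1 := by
  have := (integrable_mom k).ofReal (𝕜 := ℂ)
  refine (this.mul_bdd (c := 1) (g := fun x : ℝ => Complex.exp (t * x * Complex.I)) ?_ ?_).congr ?_
  · exact Continuous.aestronglyMeasurable (by fun_prop)
  · filter_upwards with x
    rw [← Complex.ofReal_mul, Complex.norm_exp_ofReal_mul_I]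
  · filter_upwards with x
    push_cast; rfl

lemma integrable_pow_cg (n : ℕ) : ∀ j : ℕ, Integrable (fun t : ℝ => (t : ℂ) ^ j * DD n t) := by
  have base : ∀ j : ℕ, Integrable (fun t : ℝ => (t : ℂ) ^ j * DD 0 t) := by
    intro j
    have := (integrable_rpow_mul_exp_neg_mul_sq (b := 1 / 2) (by norm_num) (s := j) (by
      have : (0 : ℝ) ≤ j := Nat.cast_nonneg j
      linarith)).ofReal (𝕜 := ℂ)
    refine this.congr ?_
    filter_upwards with t
    rw [DD_zero, cg]
    push_cast
    simp [Real.rpow_natCast]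
    left; congr 1; ring
  have h : ∀ n, (∀ j : ℕ, Integrable (fun t : ℝ => (t : ℂ) ^ j * DD n t)) ∧
      (∀ j : ℕ, Integrable (fun t : ℝ => (t : ℂ) ^ j * DD (n + 1) t)) := by
    intro n
    induction n with
    | zero =>
      refine ⟨base, fun j => ?_⟩
      refine (base (j + 1)).neg.congr ?_
      filter_upwards with t
      simp only [Pi.neg_apply, zero_add]
      rw [DD_one, DD_zero]; ring
    | succ n ih =>
      refine ⟨ih.2, fun j => ?_⟩
      refine ((ih.2 (j + 1)).neg.sub ((ih.1 j).const_mul ((n : ℂ) + 1))).congr ?_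
      filter_upwards with t
      simp only [Pi.neg_apply, Pi.sub_apply]
      rw [DD_rec]; ring
  exact (h n).1

lemma integrable_DD (n : ℕ) : Integrable (DD n) := by simpa using integrable_pow_cg n 0

lemma integral_DD_succ (n : ℕ) : ∫ t, DD (n + 1) t = 0 :=
  integral_eq_zero_of_hasDerivAt_of_integrable (fun t => DD_deriv n t) (integrable_DD _) (integrable_DD _)

noncomputable def gk (k : ℕ) (t : ℝ) : ℝ := G k ((t / 2) ^ 2) * Real.exp (-(t / 2) ^ 2 / 2)

lemma gk_eq (k : ℕ) (t : ℝ) : (gk k t : ℂ) = (-1) ^ k * DD (2 * k) (t / 2) := by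
  rw [(DD_even k (t / 2)).1, ← mul_assoc, ← mul_assoc, ← mul_pow]
  simp [gk, cg]

lemma gk_integrable (k : ℕ) : Integrable (gk k) := by
  have : Integrable (fun t => (gk k t : ℂ)) := by
    simp_rw [gk_eq]
    exact ((integrable_DD (2 * k)).comp_div (by norm_num)).const_mul _
  exact (this.re)

lemma gk_integral (k : ℕ) : ∫ t, gk k t = if k = 0 then 2 * √(2 * Real.pi) else 0 := by
  split_ifs with h
  · subst h
    have e : ∀ t, gk 0 t = Real.exp (-(1 / 8) * t ^ 2) := by intro t; simp [gk, G]; ring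
    simp_rw [e]
    rw [integral_gaussian, show Real.pi / (1 / 8) = 2 ^ 2 * (2 * Real.pi) by ring,
      Real.sqrt_mul (by norm_num), Real.sqrt_sq (by norm_num)]
  · obtain ⟨k, rfl⟩ := Nat.exists_eq_succ_of_ne_zero h
    have : ∫ t, (gk (k + 1) t : ℂ) = 0 := by
      simp_rw [gk_eq]
      rw [integral_const_mul]
      have := Measure.integral_comp_div (DD (2 * (k + 1))) 2
      rw [this, show 2 * (k + 1) = 2 * k + 1 + 1 by ring, integral_DD_succ]; simp
    have h2 : ((∫ t, gk (k + 1) t : ℝ) : ℂ) = 0 := by rw [← this]; exact integral_ofReal.symm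
    exact_mod_cast h2

end oned


section threed

open ProbabilityTheory

abbrev E3 : Type := EuclideanSpace ℝ (Fin 3)

noncomputable def ff (x : E3) : ℝ := S3 (fun k => gk k (x 0)) (fun k => gk k (x 1)) (fun k => gk k (x 2))

lemma ff_eq (x : E3) : ff x = Pf (x 0 / 2) (x 1 / 2) (x 2 / 2) *
    (Real.exp (-(x 0 / 2) ^ 2 / 2) * Real.exp (-(x 1 / 2) ^ 2 / 2) * Real.exp (-(x 2 / 2) ^ 2 / 2)) := by
  unfold ff Pf S3 gk
  simp only [Finset.sum_mul]
  refine Finset.sum_congr rfl fun i _ => Finset.sum_congr rfl fun j _ => Finset.sum_congr rfl fun k _ => ?_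
  ring

lemma ff_zero : ff 0 = 2994189595258 := by
  rw [ff_eq]; simp [Pf_zero]

lemma ff_nonpos (x : E3) (h : 8 ≤ |x 0| + |x 1| + |x 2| ∨ 6 ≤ |x 0| ∨ 6 ≤ |x 1| ∨ 6 ≤ |x 2|) : ff x ≤ 0 := by
  rw [ff_eq]
  refine mul_nonpos_of_nonpos_of_nonneg (Pf_nonpos _ _ _ ?_) (by positivity)
  have e : ∀ t : ℝ, |t / 2| = |t| / 2 := fun t => by rw [abs_div]; simp
  simp only [e]
  rcases h with h | h | h | h
  · left; linarith
  · right; left; linarith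
  · right; right; left; linarith
  · right; right; right; linarith

lemma G_cont (k : ℕ) : Continuous (G k) ∧ Continuous (G (k + 1)) := by
  induction k with
  | zero =>
    refine ⟨?_, ?_⟩
    · have : G 0 = fun _ => 1 := by funext t; simp [G]
      rw [this]; fun_prop
    · have : G 1 = fun t => 1 - t := by funext t; simp [G]
      rw [zero_add, this]; fun_prop
  | succ k ih =>
    refine ⟨ih.2, ?_⟩
    have := ih.1
    have := ih.2
    have : G (k + 1 + 1) = fun t => (4 * (k + 1 : ℝ) + 1 - t) * G (k + 1) t - 2 * (k + 1) * (2 * (k + 1) - 1) * G k t := by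
      funext t; simp [G]
    rw [this]; fun_prop

lemma gk_cont (k : ℕ) : Continuous (gk k) := by
  have := (G_cont k).1
  unfold gk; fun_prop

lemma ff_cont : Continuous ff := by
  unfold ff S3
  have := gk_cont
  fun_prop

lemma term_integrable (i j k : ℕ) : Integrable (fun x : E3 => gk i (x 0) * gk j (x 1) * gk k (x 2)) := by
  have h := Integrable.fintype_prod_dep (μ := fun _ : Fin 3 => (volume : Measure ℝ))
    (f := fun (d : Fin 3) (x : ℝ) => gk (![i, j, k] d) x) (fun d => gk_integrable _)
  rw [← volume_pi] at h
  have := (PiLp.volume_preserving_ofLp (Fin 3)).integrable_comp_of_integrable h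
  refine this.congr ?_
  filter_upwards with x
  simp [Fin.prod_univ_three]

lemma term_integral (i j k : ℕ) : ∫ x : E3, gk i (x 0) * gk j (x 1) * gk k (x 2) =
    (∫ t, gk i t) * (∫ t, gk j t) * ∫ t, gk k t := by
  have h := integral_fintype_prod_volume_eq_prod (𝕜 := ℝ) 
    (fun (d : Fin 3) (x : ℝ) => gk (![i, j, k] d) x)
  have h2 := (PiLp.volume_preserving_ofLp (Fin 3)).integral_comp (MeasurableEquiv.measurableEmbedding
    (MeasurableEquiv.toLp 2 (Fin 3 → ℝ)).symm) (fun x : Fin 3 → ℝ => ∏ d, gk (![i, j, k] d) (x d))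
  rw [h] at h2
  simpa [Fin.prod_univ_three] using h2

lemma ff_integrable : Integrable ff := by
  unfold ff S3
  refine integrable_finsetSum _ fun i _ => integrable_finsetSum _ fun j _ => integrable_finsetSum _ fun k _ => ?_
  exact (term_integrable i j k).const_mul _

lemma ff_integral : ∫ x, ff x = 2000000000000 * (2 * √(2 * Real.pi)) ^ 3 := by
  unfold ff S3
  rw [integral_finsetSum]
  swap
  · exact fun i _ => integrable_finsetSum _ fun j _ => integrable_finsetSum _ fun k _ =>
      (term_integrable i j k).const_mul _
  have : ∀ i ∈ Finset.range 10, i ≠ 0 → ∫ x : E3, (∑ j ∈ Finset.range 10, ∑ k ∈ Finset.range 10,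
      (qc i j k : ℝ) * (gk i (x 0) * gk j (x 1) * gk k (x 2))) = 0 := by
    intro i _ hi
    rw [integral_finsetSum _ fun j _ => integrable_finsetSum _ fun k _ => (term_integrable i j k).const_mul _]
    refine Finset.sum_eq_zero fun j _ => ?_
    rw [integral_finsetSum _ fun k _ => (term_integrable i j k).const_mul _]
    refine Finset.sum_eq_zero fun k _ => ?_
    rw [integral_const_mul, term_integral, gk_integral i]; simp [hi]
  rw [Finset.sum_eq_single_of_mem 0 (by simp) this,
    integral_finsetSum _ fun j _ => integrable_finsetSum _ fun k _ => (term_integrable 0 j k).const_mul _]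
  rw [Finset.sum_eq_single_of_mem 0 (by simp), integral_finsetSum _ fun k _ => (term_integrable 0 0 k).const_mul _]
  · rw [Finset.sum_eq_single_of_mem 0 (by simp)]
    · rw [integral_const_mul, term_integral, gk_integral, qc_zero]; simp; ring
    · intro k _ hk
      rw [integral_const_mul, term_integral, gk_integral k]; simp [hk]
  · intro j _ hj
    rw [integral_finsetSum _ fun k _ => (term_integrable 0 j k).const_mul _]
    refine Finset.sum_eq_zero fun k _ => ?_
    rw [integral_const_mul, term_integral, gk_integral j]; simp [hj]

noncomputable abbrev g3m : Measure (Fin 3 → ℝ) := Measure.pi (fun _ => g1)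

noncomputable def ww (ξ : Fin 3 → ℝ) : ℝ := Qf (ξ 0 ^ 2) (ξ 1 ^ 2) (ξ 2 ^ 2)

lemma ww_nonneg (ξ : Fin 3 → ℝ) : 0 ≤ ww ξ := Qf_nonneg _ _ _ (sq_nonneg _) (sq_nonneg _) (sq_nonneg _)

lemma ww_integrable : Integrable ww g3m := by
  unfold ww Qf S3
  refine integrable_finsetSum _ fun i _ => integrable_finsetSum _ fun j _ => integrable_finsetSum _ fun k _ => ?_
  refine Integrable.const_mul ?_ _
  have h := Integrable.fintype_prod_dep (μ := fun _ : Fin 3 => g1)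
    (f := fun (d : Fin 3) (x : ℝ) => (x ^ 2) ^ (![i, j, k] d)) (fun d => integrable_mom _)
  refine h.congr ?_
  filter_upwards with x
  simp [Fin.prod_univ_three]

noncomputable def ip (x : E3) (ξ : Fin 3 → ℝ) : ℝ := x 0 / 2 * ξ 0 + x 1 / 2 * ξ 1 + x 2 / 2 * ξ 2

lemma term_four (x : E3) (i j k : ℕ) :
    Integrable (fun ξ : Fin 3 → ℝ => (((ξ 0 ^ 2) ^ i * (ξ 1 ^ 2) ^ j * (ξ 2 ^ 2) ^ k : ℝ) : ℂ) *
      Complex.exp (ip x ξ * Complex.I)) g3m ∧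
    ∫ ξ : Fin 3 → ℝ, (((ξ 0 ^ 2) ^ i * (ξ 1 ^ 2) ^ j * (ξ 2 ^ 2) ^ k : ℝ) : ℂ) *
      Complex.exp (ip x ξ * Complex.I) ∂g3m = ((gk i (x 0) * gk j (x 1) * gk k (x 2) : ℝ) : ℂ) := by
  have h := Integrable.fintype_prod_dep (μ := fun _ : Fin 3 => g1)
    (f := fun (d : Fin 3) (s : ℝ) => ((s ^ 2) ^ (![i, j, k] d) : ℂ) *
      Complex.exp ((x d / 2 : ℝ) * s * Complex.I)) (fun d => integrable_mom_exp _ _)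
  have h2 := integral_fintype_prod_eq_prod (μ := fun _ : Fin 3 => g1)
    (f := fun (d : Fin 3) (s : ℝ) => ((s ^ 2) ^ (![i, j, k] d) : ℂ) *
      Complex.exp ((x d / 2 : ℝ) * s * Complex.I))
  have e : ∀ ξ : Fin 3 → ℝ, (∏ d, (((ξ d : ℂ) ^ 2) ^ (![i, j, k] d) : ℂ) *
      Complex.exp ((x d / 2 : ℝ) * (ξ d) * Complex.I)) = 
      (((ξ 0 ^ 2) ^ i * (ξ 1 ^ 2) ^ j * (ξ 2 ^ 2) ^ k : ℝ) : ℂ) *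
      Complex.exp (ip x ξ * Complex.I) := by
    intro ξ
    simp only [Fin.prod_univ_three, ip]
    push_cast
    simp only [add_mul, Complex.exp_add]
    ring
  simp only [e] at h h2
  refine ⟨h, ?_⟩
  rw [h2]
  simp only [moment_exp, Fin.prod_univ_three]
  simp only [gk, cg]
  push_cast
  simp

lemma ff_four (x : E3) : ff x = ∫ ξ, ww ξ * Real.cos (ip x ξ) ∂g3m := by
  have h1 : ∫ ξ : Fin 3 → ℝ, (ww ξ : ℂ) * Complex.exp (ip x ξ * Complex.I) ∂g3m = (ff x : ℂ) := by
    unfold ww Qf S3 ff S3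
    have hi : ∀ i j k, Integrable (fun ξ : Fin 3 → ℝ => (qc i j k : ℂ) *
      ((((ξ 0 ^ 2) ^ i * (ξ 1 ^ 2) ^ j * (ξ 2 ^ 2) ^ k : ℝ) : ℂ) *
      Complex.exp (ip x ξ * Complex.I))) g3m := fun i j k => (term_four x i j k).1.const_mul _
    have e : ∀ ξ : Fin 3 → ℝ, ((∑ i ∈ Finset.range 10, ∑ j ∈ Finset.range 10, ∑ k ∈ Finset.range 10,
        (qc i j k : ℝ) * ((ξ 0 ^ 2) ^ i * (ξ 1 ^ 2) ^ j * (ξ 2 ^ 2) ^ k) : ℝ) : ℂ) * 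
        Complex.exp (ip x ξ * Complex.I) = ∑ i ∈ Finset.range 10, ∑ j ∈ Finset.range 10, ∑ k ∈ Finset.range 10,
        (qc i j k : ℂ) * ((((ξ 0 ^ 2) ^ i * (ξ 1 ^ 2) ^ j * (ξ 2 ^ 2) ^ k : ℝ) : ℂ) *
          Complex.exp (ip x ξ * Complex.I)) := by
      intro ξ
      push_cast
      simp only [Finset.sum_mul]
      refine Finset.sum_congr rfl fun i _ => Finset.sum_congr rfl fun j _ => Finset.sum_congr rfl fun k _ => ?_
      ring
    simp only [e]
    rw [integral_finsetSum _ fun i _ => integrable_finsetSum _ fun j _ => integrable_finsetSum _ fun k _ => hi i j k]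
    simp only [Complex.ofReal_sum]
    refine Finset.sum_congr rfl fun i _ => ?_
    rw [integral_finsetSum _ fun j _ => integrable_finsetSum _ fun k _ => hi i j k]
    refine Finset.sum_congr rfl fun j _ => ?_
    rw [integral_finsetSum _ fun k _ => hi i j k]
    refine Finset.sum_congr rfl fun k _ => ?_
    rw [integral_const_mul, (term_four x i j k).2]
    push_cast; rfl
  have hint : Integrable (fun ξ : Fin 3 → ℝ => (ww ξ : ℂ) * Complex.exp (ip x ξ * Complex.I)) g3m := by
    refine (ww_integrable.ofReal (𝕜 := ℂ)).mul_bdd (c := 1) ?_ ?_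
    · refine Continuous.aestronglyMeasurable ?_
      unfold ip; fun_prop
    · filter_upwards with ξ
      rw [Complex.norm_exp_ofReal_mul_I]
  have h2 := congrArg Complex.re h1
  have h3 := integral_re (𝕜 := ℂ) hint
  simp only [RCLike.re_to_complex] at h3
  rw [← h3] at h2
  simp only [Complex.re_ofReal_mul, Complex.exp_ofReal_mul_I_re, Complex.ofReal_re] at h2
  exact h2.symm

end threed


section posdef

lemma ip_cont : Continuous (fun p : E3 × (Fin 3 → ℝ) => ip p.1 p.2) := by
  unfold ip; fun_prop

lemma ip_sub (x y : E3) (ξ : Fin 3 → ℝ) : ip (x - y) ξ = ip x ξ - ip y ξ := by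
  simp only [ip, PiLp.sub_apply]; ring

lemma swapw (μ : Measure E3) [IsFiniteMeasure μ] (b : E3 → (Fin 3 → ℝ) → ℝ) (c : ℝ)
    (hm : StronglyMeasurable (fun p : E3 × (Fin 3 → ℝ) => b p.1 p.2)) (hb : ∀ x ξ, ‖b x ξ‖ ≤ c) :
    ∫ x, ∫ ξ, ww ξ * b x ξ ∂g3m ∂μ = ∫ ξ, ww ξ * ∫ x, b x ξ ∂μ ∂g3m := by
  have hi : Integrable (fun p : E3 × (Fin 3 → ℝ) => ww p.2 * b p.1 p.2) (μ.prod g3m) := by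
    have h1 : Integrable (fun p : E3 × (Fin 3 → ℝ) => ww p.2) (μ.prod g3m) := by
      exact ww_integrable.comp_snd μ
    exact h1.mul_bdd (c := c) hm.aestronglyMeasurable (by filter_upwards with p; exact hb _ _)
  rw [integral_integral_swap hi]
  simp_rw [integral_const_mul]

noncomputable def cc (μ : Measure E3) (ξ : Fin 3 → ℝ) : ℝ := ∫ x, Real.cos (ip x ξ) ∂μ
noncomputable def ss (μ : Measure E3) (ξ : Fin 3 → ℝ) : ℝ := ∫ x, Real.sin (ip x ξ) ∂μ

lemma cos_sm : StronglyMeasurable (fun p : E3 × (Fin 3 → ℝ) => Real.cos (ip p.1 p.2)) :=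
  (Real.continuous_cos.comp ip_cont).stronglyMeasurable
lemma sin_sm : StronglyMeasurable (fun p : E3 × (Fin 3 → ℝ) => Real.sin (ip p.1 p.2)) :=
  (Real.continuous_sin.comp ip_cont).stronglyMeasurable

variable (μ ν : Measure E3) [IsFiniteMeasure μ] [IsFiniteMeasure ν]


lemma cos_int (ξ : Fin 3 → ℝ) : Integrable (fun x => Real.cos (ip x ξ)) μ := by
  refine Integrable.of_bound (C := 1) ?_ ?_
  · exact (cos_sm.comp_measurable (measurable_id.prodMk measurable_const)).aestronglyMeasurable
  · filter_upwards with x; exact Real.abs_cos_le_one _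

lemma sin_int (ξ : Fin 3 → ℝ) : Integrable (fun x => Real.sin (ip x ξ)) μ := by
  refine Integrable.of_bound (C := 1) ?_ ?_
  · exact (sin_sm.comp_measurable (measurable_id.prodMk measurable_const)).aestronglyMeasurable
  · filter_upwards with x; exact Real.abs_sin_le_one _

lemma cc_sm : StronglyMeasurable (cc μ) := cos_sm.integral_prod_left'
lemma ss_sm : StronglyMeasurable (ss μ) := sin_sm.integral_prod_left'

lemma cc_le (ξ : Fin 3 → ℝ) : ‖cc μ ξ‖ ≤ μ.real Set.univ := by
  have := norm_integral_le_of_norm_le_const (μ := μ) (f := fun x => Real.cos (ip x ξ)) (C := 1)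
    (by filter_upwards with x; exact Real.abs_cos_le_one _)
  simpa [cc, ss] using this

lemma ss_le (ξ : Fin 3 → ℝ) : ‖ss μ ξ‖ ≤ μ.real Set.univ := by
  have := norm_integral_le_of_norm_le_const (μ := μ) (f := fun x => Real.sin (ip x ξ)) (C := 1)
    (by filter_upwards with x; exact Real.abs_sin_le_one _)
  simpa [cc, ss] using this

noncomputable def KK (μ ν : Measure E3) : ℝ := ∫ x, ∫ y, ff (x - y) ∂ν ∂μ

lemma KK_eq : KK μ ν = ∫ ξ, ww ξ * (cc μ ξ * cc ν ξ + ss μ ξ * ss ν ξ) ∂g3m := by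
  have h1 : ∀ x, ∫ y, ff (x - y) ∂ν =
      ∫ ξ, ww ξ * (Real.cos (ip x ξ) * cc ν ξ + Real.sin (ip x ξ) * ss ν ξ) ∂g3m := by
    intro x
    simp_rw [ff_four, ip_sub]
    rw [swapw ν (fun y ξ => Real.cos (ip x ξ - ip y ξ)) 1]
    · refine integral_congr_ae ?_
      filter_upwards with ξ
      congr 1
      simp_rw [Real.cos_sub]
      rw [integral_add ((cos_int ν ξ).const_mul _) ((sin_int ν ξ).const_mul _), integral_const_mul,
        integral_const_mul]; rfl
    · refine Continuous.stronglyMeasurable ?_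
      have := ip_cont
      have : Continuous (fun p : E3 × (Fin 3 → ℝ) => ip x p.2) := by unfold ip; fun_prop
      fun_prop
    · intro x ξ; exact Real.abs_cos_le_one _
  unfold KK
  simp_rw [h1]
  rw [swapw μ (fun x ξ => Real.cos (ip x ξ) * cc ν ξ + Real.sin (ip x ξ) * ss ν ξ)
    (ν.real Set.univ + ν.real Set.univ)]
  · refine integral_congr_ae ?_
    filter_upwards with ξ
    congr 1
    rw [integral_add ((cos_int μ ξ).mul_const _) ((sin_int μ ξ).mul_const _), integral_mul_const,
        integral_mul_const]; rfl
  · have a : StronglyMeasurable (fun p : E3 × (Fin 3 → ℝ) => cc ν p.2) := (cc_sm ν).comp_measurable measurable_snd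
    have b : StronglyMeasurable (fun p : E3 × (Fin 3 → ℝ) => ss ν p.2) := (ss_sm ν).comp_measurable measurable_snd
    exact (cos_sm.mul a).add (sin_sm.mul b)
  · intro x ξ
    refine (norm_add_le _ _).trans ?_
    rw [norm_mul, norm_mul]
    have a := cc_le ν ξ
    have b := ss_le ν ξ
    have a' : ‖Real.cos (ip x ξ)‖ ≤ 1 := Real.abs_cos_le_one _
    have b' : ‖Real.sin (ip x ξ)‖ ≤ 1 := Real.abs_sin_le_one _
    have := mul_le_mul a' a (norm_nonneg _) zero_le_one
    have := mul_le_mul b' b (norm_nonneg _) zero_le_one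
    linarith

lemma KK_int : Integrable (fun ξ => ww ξ * (cc μ ξ * cc ν ξ + ss μ ξ * ss ν ξ)) g3m := by
  refine ww_integrable.mul_bdd (c := μ.real Set.univ * ν.real Set.univ + μ.real Set.univ * ν.real Set.univ) ?_ ?_
  · exact (((cc_sm μ).mul (cc_sm ν)).add ((ss_sm μ).mul (ss_sm ν))).aestronglyMeasurable
  · filter_upwards with ξ
    refine (norm_add_le _ _).trans ?_
    rw [norm_mul, norm_mul]
    have := mul_le_mul (cc_le μ ξ) (cc_le ν ξ) (norm_nonneg _) measureReal_nonneg
    have := mul_le_mul (ss_le μ ξ) (ss_le ν ξ) (norm_nonneg _) measureReal_nonneg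
    linarith

lemma KK_pos (ρ : ℝ) : 0 ≤ KK μ μ - 2 * ρ * KK μ ν + ρ ^ 2 * KK ν ν := by
  rw [KK_eq, KK_eq, KK_eq, ← integral_const_mul, ← integral_const_mul,
    ← integral_sub (KK_int μ μ) ((KK_int μ ν).const_mul (2 * ρ)),
    ← integral_add (f := fun ξ => ww ξ * (cc μ ξ * cc μ ξ + ss μ ξ * ss μ ξ) -
      2 * ρ * (ww ξ * (cc μ ξ * cc ν ξ + ss μ ξ * ss ν ξ))) ((KK_int μ μ).sub ((KK_int μ ν).const_mul (2 * ρ)))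
      ((KK_int ν ν).const_mul (ρ ^ 2))]
  refine integral_nonneg fun ξ => ?_
  simp only [Pi.zero_apply]
  have := mul_nonneg (ww_nonneg ξ) (add_nonneg (sq_nonneg (cc μ ξ - ρ * cc ν ξ)) (sq_nonneg (ss μ ξ - ρ * ss ν ξ)))
  linarith

end posdef



section dens

noncomputable def II : ℝ := ∫ x, ff x
noncomputable def AA : ℝ := ∫ x, |ff x|

lemma II_pos : 0 < II := by
  rw [II, ff_integral]; positivity

lemma AA_nonneg : 0 ≤ AA := integral_nonneg fun _ => abs_nonneg _

noncomputable def tail (L : ℝ) : ℝ := ∫ z in (closedBall (0 : E3) L)ᶜ, |ff z|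

lemma tail_small (η : ℝ) (hη : 0 < η) : ∃ L : ℝ, 0 ≤ L ∧ tail L ≤ η := by
  have h := tendsto_setIntegral_of_antitone (μ := (volume : Measure E3)) (f := fun z => |ff z|)
    (s := fun n : ℕ => (closedBall (0 : E3) n)ᶜ) (fun n => measurableSet_closedBall.compl)
    (fun m n hmn => Set.compl_subset_compl.2 (closedBall_subset_closedBall (by exact_mod_cast hmn)))
    ⟨0, ff_integrable.abs.integrableOn⟩
  have e : ⋂ n : ℕ, (closedBall (0 : E3) n)ᶜ = ∅ := by
    rw [Set.eq_empty_iff_forall_notMem]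
    intro z hz
    obtain ⟨n, hn⟩ := exists_nat_ge ‖z‖
    have := Set.mem_iInter.1 hz n
    simp at this
    linarith
  rw [e] at h
  simp only [Measure.restrict_empty, integral_zero_measure] at h
  obtain ⟨n, hn⟩ := (h.eventually (gt_mem_nhds hη)).exists
  exact ⟨n, by positivity, hn.le⟩

lemma ffsub_int (x : E3) : Integrable (fun z => ff (x - z)) := ff_integrable.comp_sub_left x

lemma inner_le (x : E3) (W : Set E3) : ∫ z in W, ff (x - z) ≤ AA := by
  calc ∫ z in W, ff (x - z) ≤ ∫ z in W, |ff (x - z)| :=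
        integral_mono (ffsub_int x).integrableOn (ffsub_int x).abs.integrableOn fun z => le_abs_self _
    _ ≤ ∫ z, |ff (x - z)| := setIntegral_le_integral (ffsub_int x).abs (by filter_upwards with z; exact abs_nonneg _)
    _ = AA := integral_sub_left_eq_self (fun z => |ff z|) volume x

lemma inner_approx (x : E3) (W : Set E3) (hW : MeasurableSet W) (L : ℝ) (h : closedBall x L ⊆ W) :
    |(∫ z in W, ff (x - z)) - II| ≤ tail L := by
  have h1 : II = ∫ z, ff (x - z) := (integral_sub_left_eq_self ff volume x).symm
  rw [h1, ← integral_add_compl hW (ffsub_int x), sub_add_cancel_left, abs_neg]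
  refine (abs_integral_le_integral_abs).trans ?_
  calc ∫ z in Wᶜ, |ff (x - z)| ≤ ∫ z in (closedBall x L)ᶜ, |ff (x - z)| :=
        setIntegral_mono_set (ffsub_int x).abs.integrableOn (by filter_upwards with z; exact abs_nonneg _)
          (Eventually.of_forall (Set.compl_subset_compl.2 h))
    _ = tail L := by
      unfold tail
      rw [← integral_indicator measurableSet_closedBall.compl, ← integral_indicator measurableSet_closedBall.compl,
        ← integral_sub_left_eq_self ((closedBall (0 : E3) L)ᶜ.indicator fun z => |ff z|) volume x]
      refine integral_congr_ae ?_
      filter_upwards with z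
      have : z ∈ (closedBall x L)ᶜ ↔ x - z ∈ (closedBall (0 : E3) L)ᶜ := by
        simp [dist_eq_norm, norm_sub_rev]
      by_cases hz : z ∈ (closedBall x L)ᶜ
      · rw [Set.indicator_of_mem hz, Set.indicator_of_mem (this.1 hz)]
      · rw [Set.indicator_of_notMem hz, Set.indicator_of_notMem (fun h => hz (this.2 h))]

lemma finite_bound (S : Finset E3) (c : E3) (r L : ℝ) (hL : 0 ≤ L)
    (hS : ∀ x ∈ S, x ∈ closedBall c r) (hf : ∀ x ∈ S, ∀ y ∈ S, x ≠ y → ff (x - y) ≤ 0)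
    (V V1 : ℝ) (hV : V = volume.real (closedBall c (r + L))) (hV1 : V1 = volume.real (closedBall c r))
    (hVp : 0 < V) :
    (S.card : ℝ) * (V * (II - 3 * tail L) - (V - V1) * AA) ≤ ff 0 * V ^ 2 := by
  classical
  set W := closedBall c (r + L) with hWdef
  have hW : MeasurableSet W := measurableSet_closedBall
  have hWfin : volume W ≠ ⊤ := measure_closedBall_lt_top.ne
  have : IsFiniteMeasure (volume.restrict W) := ⟨by simpa using measure_closedBall_lt_top⟩
  set N : ℝ := (S.card : ℝ) with hN
  set κ : Measure E3 := ∑ x ∈ S, Measure.dirac x with hκ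
  set ν : Measure E3 := volume.restrict W with hν
  have dint : ∀ (g : E3 → ℝ), ∫ x, g x ∂κ = ∑ x ∈ S, g x := by
    intro g
    rw [hκ, integral_finsetSum_measure]
    · simp
    · intro x _
      exact integrable_dirac (by simp)
  have tl : 0 ≤ tail L := integral_nonneg fun _ => abs_nonneg _
  have sub : ∀ x ∈ closedBall c r, closedBall x L ⊆ W := by
    intro x hx z hz
    rw [mem_closedBall] at *
    linarith [dist_triangle z x c]
  -- the three terms
  have k1 : KK κ κ ≤ N * ff 0 := by
    unfold KK
    rw [dint]
    simp_rw [dint]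
    calc ∑ x ∈ S, ∑ y ∈ S, ff (x - y) ≤ ∑ x ∈ S, ff 0 := by
          refine Finset.sum_le_sum fun x hx => ?_
          rw [← Finset.add_sum_erase S _ hx, sub_self]
          have : ∑ y ∈ S.erase x, ff (x - y) ≤ 0 := by
            refine Finset.sum_nonpos fun y hy => ?_
            rw [Finset.mem_erase] at hy
            exact hf x hx y hy.2 (Ne.symm hy.1)
          linarith
      _ = N * ff 0 := by simp [hN]
  have k2 : N * (II - tail L) ≤ KK κ ν := by
    unfold KK
    rw [dint]
    calc N * (II - tail L) = ∑ x ∈ S, (II - tail L) := by rw [Finset.sum_const, nsmul_eq_mul]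
      _ ≤ _ := by
        refine Finset.sum_le_sum fun x hx => ?_
        have := abs_le.1 (inner_approx x W hW L (sub x (hS x hx)))
        linarith
  have k3 : KK ν ν ≤ V * (II + tail L) + (V - V1) * AA := by
    unfold KK
    have hsub : closedBall c r ⊆ W := closedBall_subset_closedBall (by linarith)
    have e1 : ∫ x in W, ((II + tail L) + (W \ closedBall c r).indicator (fun _ => AA) x) =
        V * (II + tail L) + (V - V1) * AA := by
      rw [integral_add (integrable_const _) ((integrable_const _).indicator (hW.diff measurableSet_closedBall)),
        setIntegral_const, ← hV, integral_indicator (hW.diff measurableSet_closedBall),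
        Measure.restrict_restrict (hW.diff measurableSet_closedBall),
        Set.inter_eq_left.2 Set.sdiff_subset, setIntegral_const, measureReal_sdiff hsub measurableSet_closedBall,
        ← hV, ← hV1]
      simp
    rw [← e1]
    refine setIntegral_mono_on ?_ ?_ hW ?_
    · refine Measure.integrableOn_of_bounded (M := AA) hWfin ?_ ?_
      · have : StronglyMeasurable (fun p : E3 × E3 => ff (p.1 - p.2)) :=
          (ff_cont.comp (continuous_fst.sub continuous_snd)).stronglyMeasurable
        exact this.integral_prod_right'.aestronglyMeasurable
      · filter_upwards with x
        refine (norm_integral_le_integral_norm _).trans ?_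
        calc ∫ z in W, |ff (x - z)| ≤ ∫ z, |ff (x - z)| := setIntegral_le_integral (ffsub_int x).abs (by filter_upwards with z; exact abs_nonneg _)
          _ = AA := integral_sub_left_eq_self (fun z => |ff z|) volume x
    · exact (integrable_const _).add ((integrable_const _).indicator (hW.diff measurableSet_closedBall))
    · intro x hx
      by_cases hxr : x ∈ closedBall c r
      · have := abs_le.1 (inner_approx x W hW L (sub x hxr))
        rw [Set.indicator_of_notMem (fun h => h.2 hxr)]
        linarith
      · rw [Set.indicator_of_mem (show x ∈ W \ closedBall c r from ⟨hx, hxr⟩)]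
        have h1 := inner_le x W
        have h2 := II_pos
        linarith
  have k0 := KK_pos κ ν (N / V)
  have e : N * ff 0 - 2 * (N / V) * (N * (II - tail L)) + (N / V) ^ 2 * (V * (II + tail L) + (V - V1) * AA) =
      N / V ^ 2 * (ff 0 * V ^ 2 - N * (V * (II - 3 * tail L) - (V - V1) * AA)) := by
    field_simp; ring
  have hN0 : 0 ≤ N := Nat.cast_nonneg _
  have k4 : 0 ≤ N / V ^ 2 * (ff 0 * V ^ 2 - N * (V * (II - 3 * tail L) - (V - V1) * AA)) := by
    rw [← e]
    have a := mul_le_mul_of_nonneg_left k2 (show 0 ≤ 2 * (N / V) by positivity)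
    have b := mul_le_mul_of_nonneg_left k3 (show 0 ≤ (N / V) ^ 2 by positivity)
    linarith
  rcases eq_or_lt_of_le hN0 with h0 | h0
  · rw [← h0, zero_mul, ff_zero]; positivity
  · have := nonneg_of_mul_nonneg_right k4 (by positivity)
    linarith

end dens


section density

lemma II_lb : 2.5195e14 ≤ II := by
  rw [II, ff_integral]
  have h1 : (2.5065 : ℝ) ≤ √(2 * Real.pi) := by
    apply Real.le_sqrt_of_sq_le
    have := Real.pi_gt_d4
    norm_num at *
    linarith
  have h2 : ((5.013 : ℝ)) ^ 3 ≤ (2 * √(2 * Real.pi)) ^ 3 := by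
    gcongr
    linarith
  norm_num at *
  linarith

lemma cube_ratio (s : ℝ) : Tendsto (fun r : ℝ => (r + s) ^ 3 / r ^ 3) atTop (nhds 1) := by
  have h : Tendsto (fun r : ℝ => (1 + s * r⁻¹) ^ 3) atTop (nhds ((1 + s * 0) ^ 3)) :=
    ((tendsto_inv_atTop_zero.const_mul s).const_add 1).pow 3
  rw [mul_zero, add_zero, one_pow] at h
  refine h.congr' ?_
  filter_upwards [eventually_gt_atTop 0] with r hr
  field_simp

lemma ball_vol (c : E3) (r : ℝ) (hr : 0 ≤ r) :
    volume.real (closedBall c r) = r ^ 3 * volume.real (closedBall (0 : E3) 1) := by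
  rw [Measure.addHaar_real_closedBall' _ _ hr]
  simp

lemma omega_pos : 0 < volume.real (closedBall (0 : E3) 1) := by
  refine ENNReal.toReal_pos (measure_closedBall_pos _ _ one_pos).ne' measure_closedBall_lt_top.ne

lemma card_bound : ∃ R : ℝ, 0 < R ∧ ∀ r ≥ R, ∀ (c : E3) (S : Finset E3),
    (∀ x ∈ S, x ∈ closedBall c (r + 4)) → (∀ x ∈ S, ∀ y ∈ S, x ≠ y → ff (x - y) ≤ 0) →
    (S.card : ℝ) * (184 / 3) ≤ 0.7293 * volume.real (closedBall c r) := by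
  have hII := II_lb
  obtain ⟨L, hL, ht⟩ := tail_small (II / 10 ^ 6) (by positivity [II_pos])
  set t := tail L with htd
  have e1 := cube_ratio (4 + L)
  have e2 := cube_ratio 4
  have e3 : Tendsto (fun r : ℝ => (184 / 3) * ff 0 * ((r + (4 + L)) ^ 3 / r ^ 3) ^ 2) atTop
      (nhds ((184 / 3) * ff 0 * 1 ^ 2)) := (e1.pow 2).const_mul _
  have e4 : Tendsto (fun r : ℝ => 0.7293 * (((r + (4 + L)) ^ 3 / r ^ 3) * (II - 3 * t) -
      ((r + (4 + L)) ^ 3 / r ^ 3 - (r + 4) ^ 3 / r ^ 3) * AA)) atTop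
      (nhds (0.7293 * (1 * (II - 3 * t) - (1 - 1) * AA))) :=
    ((e1.mul_const _).sub ((e1.sub e2).mul_const _)).const_mul _
  have lt : (184 / 3) * ff 0 * 1 ^ 2 < 0.7293 * (1 * (II - 3 * t) - (1 - 1) * AA) := by
    rw [ff_zero]
    norm_num at *
    linarith
  obtain ⟨R, hR⟩ := eventually_atTop.1 (e3.eventually_lt e4 lt)
  refine ⟨max R 1, by positivity, ?_⟩
  intro r hr c S hS hf
  have hr0 : 0 < r := lt_of_lt_of_le (by positivity) hr
  have h1 := hR r (le_trans (le_max_left _ _) hr)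
  have hw := omega_pos
  set w := volume.real (closedBall (0 : E3) 1) with hwd
  have hb := finite_bound S c (r + 4) L hL hS hf ((r + (4 + L)) ^ 3 * w) ((r + 4) ^ 3 * w)
    (by rw [ball_vol _ _ (by linarith), add_assoc]) (by rw [ball_vol _ _ (by linarith)]) (by positivity)
  rw [ball_vol _ _ hr0.le, ← hwd]
  rw [← htd] at hb
  set a := (r + (4 + L)) ^ 3 / r ^ 3 with ha
  set b := (r + 4) ^ 3 / r ^ 3 with hbd
  have hA : (r + (4 + L)) ^ 3 = a * r ^ 3 := by rw [ha]; field_simp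
  have hB : (r + 4) ^ 3 = b * r ^ 3 := by rw [hbd]; field_simp
  rw [hA, hB] at hb
  have hap : 0 < a := by positivity
  have hf0 : 0 < ff 0 := by rw [ff_zero]; norm_num
  set D := a * (II - 3 * t) - (a - b) * AA with hD
  have hDp : 0 < D := by
    have : 0 < 184 / 3 * ff 0 * a ^ 2 := by positivity
    linarith
  have hb' : (r ^ 3 * w) * ((S.card : ℝ) * D) ≤ (r ^ 3 * w) * (ff 0 * a ^ 2 * (r ^ 3 * w)) := by
    calc _ = _ := ?_
      _ ≤ _ := hb
      _ = _ := by ring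
    rw [hD]; ring
  have hb2 := le_of_mul_le_mul_left hb' (by positivity)
  refine le_of_mul_le_mul_right (a := D) ?_ hDp
  have hq : 0 < r ^ 3 * w := by positivity
  have := mul_le_mul_of_nonneg_right h1.le hq.le
  linarith

theorem density_bound (TT X : Set E3) (hvol : volume TT ≤ ENNReal.ofReal (184 / 3))
    (hball : TT ⊆ closedBall 0 4) (hX : ∀ x ∈ X, ∀ y ∈ X, x ≠ y → ff (x - y) ≤ 0) :
    packingUpperDensity TT X ≤ 0.7293 := by
  obtain ⟨R, hR0, hR⟩ := card_bound
  unfold packingUpperDensity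
  have nn : ∀ r : ℝ, 0 ≤ ⨆ c : E3, (volume (closedBall c r ∩ ⋃ x ∈ X, (fun z => x + z) '' TT) /
      volume (closedBall c r)).toReal := fun r => Real.iSup_nonneg fun c => ENNReal.toReal_nonneg
  refine limsup_le_of_le ⟨0, ?_⟩ ?_
  · intro a ha
    obtain ⟨r, hr⟩ := (eventually_map.1 ha).exists
    exact (nn r).trans hr
  filter_upwards [eventually_ge_atTop R] with r hr
  have hr0 : 0 < r := hR0.trans_le hr
  refine ciSup_le fun c => ?_
  set Y := X ∩ closedBall c (r + 4) with hY
  have key : ∀ S : Finset E3, (S : Set E3) ⊆ Y →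
      (S.card : ℝ) * (184 / 3) ≤ 0.7293 * volume.real (closedBall c r) := fun S hS =>
    hR r hr c S (fun x hx => (hS hx).2) (fun x hx y hy => hX x (hS hx).1 y (hS hy).1)
  have hfin : Y.Finite := by
    by_contra hinf
    obtain ⟨n, hn⟩ := exists_nat_gt (0.7293 * volume.real (closedBall c r))
    obtain ⟨S, hS, hc⟩ := Set.Infinite.exists_subset_card_eq hinf n
    have := key S hS
    rw [hc] at this
    have h0 : (0 : ℝ) ≤ n := Nat.cast_nonneg n
    linarith
  have hk := key hfin.toFinset (by simp)
  have hsub : closedBall c r ∩ ⋃ x ∈ X, (fun z => x + z) '' TT ⊆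
      ⋃ x ∈ hfin.toFinset, (fun z => x + z) '' TT := by
    rintro p ⟨hp, hp2⟩
    simp only [Set.mem_iUnion] at hp2 ⊢
    obtain ⟨x, hx, z, hz, rfl⟩ := hp2
    refine ⟨x, ?_, z, hz, rfl⟩
    rw [Set.Finite.mem_toFinset]
    refine ⟨hx, ?_⟩
    have h1 := hball hz
    rw [mem_closedBall] at *
    have : dist x (x + z) = dist z 0 := by simp [dist_eq_norm]
    simp only at hp
    linarith [dist_triangle x (x + z) c]
  have hv : volume (closedBall c r ∩ ⋃ x ∈ X, (fun z => x + z) '' TT) ≤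
      ENNReal.ofReal (hfin.toFinset.card * (184 / 3)) := by
    calc _ ≤ _ := measure_mono hsub
      _ ≤ ∑ x ∈ hfin.toFinset, volume ((fun z => x + z) '' TT) := measure_biUnion_finset_le _ _
      _ ≤ ∑ x ∈ hfin.toFinset, ENNReal.ofReal (184 / 3) := by
        refine Finset.sum_le_sum fun x _ => ?_
        rw [Set.image_add_left, measure_preimage_add]
        exact hvol
      _ = _ := by
        rw [Finset.sum_const, nsmul_eq_mul, ENNReal.ofReal_mul (Nat.cast_nonneg _), ENNReal.ofReal_natCast]
  refine ENNReal.toReal_le_of_le_ofReal (by norm_num) ?_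
  refine ENNReal.div_le_of_le_mul ?_
  refine hv.trans ?_
  refine (ENNReal.ofReal_le_ofReal hk).trans ?_
  rw [ENNReal.ofReal_mul (by norm_num), ofReal_measureReal measure_closedBall_lt_top.ne]

end density


section geom

def VS : Set E3 := {v : EuclideanSpace ℝ (Fin 3) | ∃ (σ : Equiv.Perm (Fin 3)) (ε : Fin 3 → ℝ),
        (ε = ![1, 1, 1] ∨ ε = ![1, -1, -1] ∨ ε = ![-1, 1, -1] ∨ ε = ![-1, -1, 1]) ∧
        v = fun i => ε i * ![1, 1, 3] (σ i)}

lemma VS_mem (σ : Equiv.Perm (Fin 3)) (e0 e1 e2 a b c : ℝ)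
    (he : (![e0, e1, e2] : Fin 3 → ℝ) = ![1, 1, 1] ∨ (![e0, e1, e2] : Fin 3 → ℝ) = ![1, -1, -1] ∨
      (![e0, e1, e2] : Fin 3 → ℝ) = ![-1, 1, -1] ∨ (![e0, e1, e2] : Fin 3 → ℝ) = ![-1, -1, 1])
    (ha : a = e0 * ![1, 1, 3] (σ 0)) (hb : b = e1 * ![1, 1, 3] (σ 1)) (hc : c = e2 * ![1, 1, 3] (σ 2)) :
    !₂[a, b, c] ∈ convexHull ℝ VS := by
  refine subset_convexHull ℝ _ ⟨σ, ![e0, e1, e2], he, ?_⟩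
  funext i
  fin_cases i
  · exact ha
  · exact hb
  · exact hc

lemma VS_tri (s : Set E3) (hs : Convex ℝ s) (h : ∀ a b c : ℝ,
    (a = 1 ∧ b = 1 ∧ c = 3) ∨ (a = 1 ∧ b = 3 ∧ c = 1) ∨ (a = 3 ∧ b = 1 ∧ c = 1) →
    !₂[a, b, c] ∈ s ∧ !₂[a, -b, -c] ∈ s ∧ !₂[-a, b, -c] ∈ s ∧ !₂[-a, -b, c] ∈ s) :
    convexHull ℝ VS ⊆ s := by
  refine convexHull_min ?_ hs
  rintro v ⟨σ, ε, he, hv⟩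
  have habc : ((![1, 1, 3] : Fin 3 → ℝ) (σ 0) = 1 ∧ (![1, 1, 3] : Fin 3 → ℝ) (σ 1) = 1 ∧ (![1, 1, 3] : Fin 3 → ℝ) (σ 2) = 3) ∨
      ((![1, 1, 3] : Fin 3 → ℝ) (σ 0) = 1 ∧ (![1, 1, 3] : Fin 3 → ℝ) (σ 1) = 3 ∧ (![1, 1, 3] : Fin 3 → ℝ) (σ 2) = 1) ∨
      ((![1, 1, 3] : Fin 3 → ℝ) (σ 0) = 3 ∧ (![1, 1, 3] : Fin 3 → ℝ) (σ 1) = 1 ∧ (![1, 1, 3] : Fin 3 → ℝ) (σ 2) = 1) := by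
    have h01 : σ 0 ≠ σ 1 := fun h => by simpa using σ.injective h
    have h02 : σ 0 ≠ σ 2 := fun h => by simpa using σ.injective h
    have h12 : σ 1 ≠ σ 2 := fun h => by simpa using σ.injective h
    revert h01 h02 h12
    generalize σ 0 = i
    generalize σ 1 = j
    generalize σ 2 = k
    fin_cases i <;> fin_cases j <;> fin_cases k <;> simp
  have H := h _ _ _ habc
  have hv' : v = !₂[ε 0 * ![1, 1, 3] (σ 0), ε 1 * ![1, 1, 3] (σ 1), ε 2 * ![1, 1, 3] (σ 2)] := by
    ext i
    rw [hv]
    fin_cases i <;> rfl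
  rw [hv']
  rcases he with rfl | rfl | rfl | rfl
  · simpa using H.1
  · simpa using H.2.1
  · simpa using H.2.2.1
  · simpa using H.2.2.2

lemma TT_ball : convexHull ℝ VS ⊆ closedBall (0 : E3) 4 := by
  refine VS_tri _ (convex_closedBall _ _) ?_
  have : ∀ a b c : ℝ, a ^ 2 + b ^ 2 + c ^ 2 = 11 → !₂[a, b, c] ∈ closedBall (0 : E3) 4 := by
    intro a b c h
    rw [mem_closedBall_zero_iff, EuclideanSpace.norm_eq]
    rw [Real.sqrt_le_left (by norm_num)]
    simp [Fin.sum_univ_three]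
    linarith
  rintro a b c (⟨rfl, rfl, rfl⟩ | ⟨rfl, rfl, rfl⟩ | ⟨rfl, rfl, rfl⟩) <;>
    refine ⟨this _ _ _ ?_, this _ _ _ ?_, this _ _ _ ?_, this _ _ _ ?_⟩ <;> norm_num

lemma combo (F1 F2 F3 w1 w2 w3 u : ℝ) (h12 : F2 ≤ F1) (h23 : F3 ≤ F2) (h3 : 0 ≤ F3)
    (p2 : 0 ≤ w2) (p3 : 0 ≤ w3) (hs : w1 + w2 + w3 < 8) (h6 : w1 < 6)
    (hu : 6 * F1 + 2 * F2 ≤ u) (hu2 : u ≤ F1 * w1 + F2 * w2 + F3 * w3) (hu0 : 0 < u) : False := by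
  have a1 : F3 * w3 ≤ F2 * w3 := by gcongr
  have a2 : 0 ≤ (F1 - F2) * (6 - w1) := mul_nonneg (by linarith) (by linarith)
  have a3 : 0 ≤ F2 * (8 - (w1 + w2 + w3)) := mul_nonneg (by linarith) (by linarith)
  have a4 : (F1 - F2) * (6 - w1) = 0 := by nlinarith
  have a5 : F2 * (8 - (w1 + w2 + w3)) = 0 := by nlinarith
  have b1 : F1 - F2 = 0 := by
    rcases mul_eq_zero.1 a4 with h | h
    · exact h
    · linarith
  have b2 : F2 = 0 := by
    rcases mul_eq_zero.1 a5 with h | h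
    · exact h
    · linarith
  have b3 : F1 = 0 := by linarith
  have b4 : F3 = 0 := by linarith
  rw [b2, b3, b4] at hu2
  linarith

lemma combo' (F1 F2 F3 w1 w2 w3 u : ℝ) (g1 : 0 ≤ F1) (g2 : 0 ≤ F2) (g3 : 0 ≤ F3)
    (p1 : 0 ≤ w1) (p2 : 0 ≤ w2) (p3 : 0 ≤ w3) (hs : w1 + w2 + w3 < 8) (h1 : w1 < 6) (h2 : w2 < 6) (h3 : w3 < 6)
    (u12 : 6 * F1 + 2 * F2 ≤ u) (u13 : 6 * F1 + 2 * F3 ≤ u) (u21 : 6 * F2 + 2 * F1 ≤ u)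
    (u23 : 6 * F2 + 2 * F3 ≤ u) (u31 : 6 * F3 + 2 * F1 ≤ u) (u32 : 6 * F3 + 2 * F2 ≤ u)
    (hu2 : u ≤ F1 * w1 + F2 * w2 + F3 * w3) (hu0 : 0 < u) : False := by
  rcases le_total F1 F2 with a | a <;> rcases le_total F2 F3 with b | b <;> rcases le_total F1 F3 with c | c
  · exact combo F3 F2 F1 w3 w2 w1 u b a g1 p2 p1 (by linarith) h3 u32 (by linarith) hu0
  · exact combo F3 F2 F1 w3 w2 w1 u b a g1 p2 p1 (by linarith) h3 u32 (by linarith) hu0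
  · exact combo F2 F3 F1 w2 w3 w1 u b c g1 p3 p1 (by linarith) h2 u23 (by linarith) hu0
  · exact combo F2 F1 F3 w2 w1 w3 u a c g3 p1 p3 (by linarith) h2 u21 (by linarith) hu0
  · exact combo F3 F1 F2 w3 w1 w2 u c a g2 p1 p2 (by linarith) h3 u31 (by linarith) hu0
  · exact combo F1 F3 F2 w1 w3 w2 u c b g2 p3 p2 (by linarith) h1 u13 (by linarith) hu0
  · exact combo F1 F2 F3 w1 w2 w3 u a b g3 p2 p3 (by linarith) h1 u12 (by linarith) hu0
  · exact combo F1 F2 F3 w1 w2 w3 u a b g3 p2 p3 (by linarith) h1 u12 (by linarith) hu0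

lemma abs_pair (x y u : ℝ) (h1 : x + y ≤ u) (h2 : -x - y ≤ u) (h3 : x - y ≤ u) (h4 : y - x ≤ u) :
    |x| + |y| ≤ u := by
  rcases abs_cases x with ⟨h, _⟩ | ⟨h, _⟩ <;> rcases abs_cases y with ⟨h', _⟩ | ⟨h', _⟩ <;> linarith

lemma e3_eq (x : E3) : x = !₂[x 0, x 1, x 2] := by
  ext i; fin_cases i <;> rfl

def Tw (a b c : ℝ) : Prop :=
  !₂[a, b, c] ∈ convexHull ℝ VS ∧ !₂[a, -b, -c] ∈ convexHull ℝ VS ∧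
      !₂[-a, b, -c] ∈ convexHull ℝ VS ∧ !₂[-a, -b, c] ∈ convexHull ℝ VS

lemma twist (σ : Equiv.Perm (Fin 3)) (a b c : ℝ) (ha : a = ![1, 1, 3] (σ 0)) (hb : b = ![1, 1, 3] (σ 1)) (hc : c = ![1, 1, 3] (σ 2)) :
    Tw a b c := by
  subst ha hb hc
  refine ⟨VS_mem σ 1 1 1 _ _ _ (by tauto) ?_ ?_ ?_, VS_mem σ 1 (-1) (-1) _ _ _ (by tauto) ?_ ?_ ?_,
    VS_mem σ (-1) 1 (-1) _ _ _ (by tauto) ?_ ?_ ?_, VS_mem σ (-1) (-1) 1 _ _ _ (by tauto) ?_ ?_ ?_⟩ <;> ring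

lemma tw1 : Tw 1 1 3 := twist 1 1 1 3 (by simp) (by simp) (by simp)
lemma tw2 : Tw 1 3 1 := twist (Equiv.swap 1 2) 1 3 1 (by simp [Equiv.swap_apply_def]) (by simp) (by simp)
lemma tw3 : Tw 3 1 1 := twist (Equiv.swap 0 2) 3 1 1 (by simp) (by simp [Equiv.swap_apply_def]) (by simp)

lemma mid_mem (a b c a' b' c' x y z : ℝ) (h : !₂[a, b, c] ∈ convexHull ℝ VS) (h' : !₂[a', b', c'] ∈ convexHull ℝ VS)
    (hx : x = (a + a') / 2) (hy : y = (b + b') / 2) (hz : z = (c + c') / 2) : !₂[x, y, z] ∈ convexHull ℝ VS := by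
  have := (convex_convexHull ℝ VS) h h' (show (0 : ℝ) ≤ 1 / 2 by norm_num) (show (0 : ℝ) ≤ 1 / 2 by norm_num) (by norm_num)
  convert this using 1
  ext i
  fin_cases i <;> simp [hx, hy, hz] <;> ring

lemma zero_int : (0 : E3) ∈ interior (convexHull ℝ VS) := by
  have x1 : !₂[1, 0, 0] ∈ convexHull ℝ VS := mid_mem _ _ _ _ _ _ _ _ _ tw1.1 tw1.2.1 (by norm_num) (by norm_num) (by norm_num)
  have x2 : !₂[-1, 0, 0] ∈ convexHull ℝ VS := mid_mem _ _ _ _ _ _ _ _ _ tw1.2.2.1 tw1.2.2.2 (by norm_num) (by norm_num) (by norm_num)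
  have y1 : !₂[0, 1, 0] ∈ convexHull ℝ VS := mid_mem _ _ _ _ _ _ _ _ _ tw1.1 tw1.2.2.1 (by norm_num) (by norm_num) (by norm_num)
  have y2 : !₂[0, -1, 0] ∈ convexHull ℝ VS := mid_mem _ _ _ _ _ _ _ _ _ tw1.2.1 tw1.2.2.2 (by norm_num) (by norm_num) (by norm_num)
  have z1 : !₂[0, 0, 1] ∈ convexHull ℝ VS := mid_mem _ _ _ _ _ _ _ _ _ tw2.1 tw2.2.2.2 (by norm_num) (by norm_num) (by norm_num)
  have z2 : !₂[0, 0, -1] ∈ convexHull ℝ VS := mid_mem _ _ _ _ _ _ _ _ _ tw2.2.1 tw2.2.2.1 (by norm_num) (by norm_num) (by norm_num)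
  have cv := convex_convexHull ℝ VS
  have seg : ∀ (p q : E3), p ∈ convexHull ℝ VS → q ∈ convexHull ℝ VS → ∀ t : ℝ, |t| ≤ 1 →
      ((1 + t) / 2) • p + ((1 - t) / 2) • q ∈ convexHull ℝ VS := by
    intro p q hp hq t ht
    rw [abs_le] at ht
    exact cv hp hq (by linarith) (by linarith) (by ring)
  rw [mem_interior_iff_mem_nhds]
  have : {x : E3 | |3 * x 0| < 1} ∩ {x : E3 | |3 * x 1| < 1} ∩ {x : E3 | |3 * x 2| < 1} ∈ nhds (0 : E3) := by
    refine IsOpen.mem_nhds ?_ (by simp)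
    exact ((isOpen_lt (by fun_prop) (by fun_prop)).inter (isOpen_lt (by fun_prop) (by fun_prop))).inter
      (isOpen_lt (by fun_prop) (by fun_prop))
  refine mem_of_superset this ?_
  rintro x ⟨⟨h0, h1⟩, h2⟩
  have k0 := seg _ _ x1 x2 _ h0.le
  have k1 := seg _ _ y1 y2 _ h1.le
  have k2 := seg _ _ z1 z2 _ h2.le
  have k3 := cv k0 k1 (show (0 : ℝ) ≤ 1 / 2 by norm_num) (show (0 : ℝ) ≤ 1 / 2 by norm_num) (by norm_num)
  have k4 := cv k3 k2 (show (0 : ℝ) ≤ 2 / 3 by norm_num) (show (0 : ℝ) ≤ 1 / 3 by norm_num) (by norm_num)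
  convert k4 using 1
  ext i
  fin_cases i <;> simp <;> ring

lemma scale_int (x : E3) (hx : x ∈ convexHull ℝ VS) (s : ℝ) (h0 : 0 ≤ s) (h1 : s < 1) :
    s • x ∈ interior (convexHull ℝ VS) := by
  have := (convex_convexHull ℝ VS).combo_interior_self_mem_interior zero_int hx (show 0 < 1 - s by linarith) h0 (by ring)
  simpa using this

open scoped Pointwise in
lemma diff_mem (v : E3) (hs : |v 0| + |v 1| + |v 2| < 8) (h0 : |v 0| < 6) (h1 : |v 1| < 6) (h2 : |v 2| < 6) :
    v ∈ interior (convexHull ℝ VS) - interior (convexHull ℝ VS) := by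
  by_contra hv
  have cv := (convex_convexHull ℝ VS).interior
  obtain ⟨f, hf⟩ := geometric_hahn_banach_open_point (cv.sub cv) (isOpen_interior.sub_right) hv
  have hu0 : 0 < f v := by
    have := hf (0 - 0) (Set.sub_mem_sub zero_int zero_int)
    simpa using this
  have hP : ∀ p ∈ convexHull ℝ VS, ∀ q ∈ convexHull ℝ VS, f p - f q ≤ f v := by
    intro p hp q hq
    by_contra hcon
    push Not at hcon
    have hd : 0 < f p - f q := hu0.trans hcon
    set s := f v / (f p - f q) with hsd
    have s0 : 0 ≤ s := by positivity
    have s1 : s < 1 := by rw [hsd, div_lt_one hd]; exact hcon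
    have := hf _ (Set.sub_mem_sub (scale_int p hp s s0 s1) (scale_int q hq s s0 s1))
    rw [← smul_sub, map_smul, map_sub, smul_eq_mul, hsd, div_mul_cancel₀ _ hd.ne'] at this
    exact lt_irrefl _ this
  set f0 := f !₂[1, 0, 0] with hf0
  set f1 := f !₂[0, 1, 0] with hf1
  set f2 := f !₂[0, 0, 1] with hf2
  have lin : ∀ a b c : ℝ, f !₂[a, b, c] = a * f0 + b * f1 + c * f2 := by
    intro a b c
    have : (!₂[a, b, c] : E3) = a • !₂[1, 0, 0] + b • !₂[0, 1, 0] + c • !₂[0, 0, 1] := by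
      ext i; fin_cases i <;> simp
    rw [this]
    simp only [map_add, map_smul, smul_eq_mul, hf0, hf1, hf2]
  have hfv : f v = v 0 * f0 + v 1 * f1 + v 2 * f2 := by
    conv_lhs => rw [e3_eq v]
    exact lin _ _ _
  have D : ∀ a b c a' b' c' : ℝ, !₂[a, b, c] ∈ convexHull ℝ VS → !₂[a', b', c'] ∈ convexHull ℝ VS →
      (a - a') * f0 + (b - b') * f1 + (c - c') * f2 ≤ f v ∧ (a' - a) * f0 + (b' - b) * f1 + (c' - c) * f2 ≤ f v := by
    intro a b c a' b' c' h h'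
    have e1 := hP _ h _ h'
    have e2 := hP _ h' _ h
    rw [lin, lin] at e1 e2
    constructor <;> linarith
  have P : ∀ x y u : ℝ, (x + y ≤ u ∧ -x - y ≤ u) → (x - y ≤ u ∧ y - x ≤ u) → |x| + |y| ≤ u :=
    fun x y u h h' => abs_pair x y u h.1 h.2 h'.1 h'.2
  obtain ⟨a1, a2, a3, a4⟩ := tw1
  obtain ⟨b1, b2, b3, b4⟩ := tw2
  obtain ⟨c1, c2, c3, c4⟩ := tw3
  have q01 := P (6 * f0) (2 * f1) (f v) (by convert D _ _ _ _ _ _ c1 c4 using 2 <;> ring)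
    (by convert D _ _ _ _ _ _ c2 c3 using 2 <;> ring)
  have q02 := P (6 * f0) (2 * f2) (f v) (by convert D _ _ _ _ _ _ c1 c3 using 2 <;> ring)
    (by convert D _ _ _ _ _ _ c2 c4 using 2 <;> ring)
  have q10 := P (6 * f1) (2 * f0) (f v) (by convert D _ _ _ _ _ _ b1 b4 using 2 <;> ring)
    (by convert D _ _ _ _ _ _ b3 b2 using 2 <;> ring)
  have q12 := P (6 * f1) (2 * f2) (f v) (by convert D _ _ _ _ _ _ b1 b2 using 2 <;> ring)
    (by convert D _ _ _ _ _ _ b3 b4 using 2 <;> ring)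
  have q20 := P (6 * f2) (2 * f0) (f v) (by convert D _ _ _ _ _ _ a1 a3 using 2 <;> ring)
    (by convert D _ _ _ _ _ _ a4 a2 using 2 <;> ring)
  have q21 := P (6 * f2) (2 * f1) (f v) (by convert D _ _ _ _ _ _ a1 a2 using 2 <;> ring)
    (by convert D _ _ _ _ _ _ a4 a3 using 2 <;> ring)
  simp only [abs_mul, Nat.abs_ofNat] at q01 q02 q10 q12 q20 q21
  have up : ∀ a b : ℝ, a * b ≤ |b| * |a| := fun a b => by
    rw [← abs_mul, mul_comm]; exact le_abs_self _
  refine combo' |f0| |f1| |f2| |v 0| |v 1| |v 2| (f v) (abs_nonneg _) (abs_nonneg _) (abs_nonneg _)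
    (abs_nonneg _) (abs_nonneg _) (abs_nonneg _) hs h0 h1 h2 q01 q02 q10 q12 q20 q21 ?_ hu0
  rw [hfv]
  linarith [up (v 0) f0, up (v 1) f1, up (v 2) f2]

lemma packing_ff (X : Set E3) (hX : IsTranslativePacking (convexHull ℝ VS) X) :
    ∀ x ∈ X, ∀ y ∈ X, x ≠ y → ff (x - y) ≤ 0 := by
  intro x hx y hy hxy
  apply ff_nonpos
  by_contra hcon
  push Not at hcon
  obtain ⟨hs, h0, h1, h2⟩ := hcon
  obtain ⟨p, hp, q, hq, hpq⟩ := diff_mem (x - y) hs h0 h1 h2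
  refine Set.disjoint_left.1 (hX x hx y hy hxy) ⟨q, hq, rfl⟩ ⟨p, hp, ?_⟩
  simp only at hpq ⊢
  have : p = x - y + q := by rw [← hpq]; abel
  rw [this]; abel

end geom


section vol

noncomputable def fa (z : ℝ) : ℝ := min (3 + z) (5 - z)
noncomputable def fb (z : ℝ) : ℝ := min (3 - z) (5 + z)

def SS : Set (Fin 3 → ℝ) := {u | |u 0| ≤ fa (u 2) ∧ |u 1| ≤ fb (u 2)}

lemma lint_aux (g h : ℝ → ℝ) (l u : ℝ) (hlu : l ≤ u) (hg : Continuous g) (h0 : ∀ z ∈ Set.Icc l u, 0 ≤ g z)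
    (hd : ∀ z, HasDerivAt h (g z) z) :
    ∫⁻ z, (Set.Icc l u).indicator (fun z => ENNReal.ofReal (g z)) z = ENNReal.ofReal (h u - h l) := by
  rw [lintegral_indicator measurableSet_Icc, ← ofReal_integral_eq_lintegral_ofReal]
  · rw [integral_Icc_eq_integral_Ioc, ← intervalIntegral.integral_of_le hlu,
      intervalIntegral.integral_eq_sub_of_hasDerivAt (fun z _ => hd z) (hg.intervalIntegrable _ _)]
  · exact hg.continuousOn.integrableOn_Icc
  · filter_upwards [self_mem_ae_restrict measurableSet_Icc] with z hz using h0 z hz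

lemma sec_vol (z : ℝ) : ENNReal.ofReal (2 * fa z) * ENNReal.ofReal (2 * fb z) ≤
    (Set.Icc (-3 : ℝ) (-1)).indicator (fun z => ENNReal.ofReal (4 * ((3 + z) * (5 + z)))) z +
    (Set.Icc (-1 : ℝ) 1).indicator (fun z => ENNReal.ofReal (4 * ((3 + z) * (3 - z)))) z +
    (Set.Icc (1 : ℝ) 3).indicator (fun z => ENNReal.ofReal (4 * ((5 - z) * (3 - z)))) z := by
  have ha1 : fa z ≤ 3 + z := min_le_left _ _
  have ha2 : fa z ≤ 5 - z := min_le_right _ _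
  have hb1 : fb z ≤ 3 - z := min_le_left _ _
  have hb2 : fb z ≤ 5 + z := min_le_right _ _
  have K : ∀ p q : ℝ, fa z ≤ p → fb z ≤ q → 0 ≤ p →
      ENNReal.ofReal (2 * fa z) * ENNReal.ofReal (2 * fb z) ≤ ENNReal.ofReal (4 * (p * q)) := by
    intro p q hp hq h0
    calc _ ≤ ENNReal.ofReal (2 * p) * ENNReal.ofReal (2 * q) := by gcongr
      _ = _ := by rw [← ENNReal.ofReal_mul (by linarith)]; congr 1; ring
  by_cases h1 : z < -3
  · rw [ENNReal.ofReal_of_nonpos (show 2 * fa z ≤ 0 by linarith), zero_mul]; exact zero_le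
  by_cases h2 : 3 < z
  · rw [ENNReal.ofReal_of_nonpos (show 2 * fb z ≤ 0 by linarith), mul_zero]; exact zero_le
  push Not at h1 h2
  rcases le_total z (-1) with h | h
  · rw [Set.indicator_of_mem (show z ∈ Set.Icc (-3 : ℝ) (-1) from ⟨h1, h⟩), add_assoc]
    exact (K _ _ ha1 hb2 (by linarith)).trans le_self_add
  rcases le_total z 1 with h' | h'
  · rw [Set.indicator_of_mem (show z ∈ Set.Icc (-1 : ℝ) 1 from ⟨h, h'⟩)]
    exact (K _ _ ha1 hb1 (by linarith)).trans (le_add_self.trans le_self_add)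
  · rw [Set.indicator_of_mem (show z ∈ Set.Icc (1 : ℝ) 3 from ⟨h', h2⟩)]
    exact (K _ _ ha2 hb1 (by linarith)).trans le_add_self

lemma fa_cont : Continuous fa := by unfold fa; fun_prop
lemma fb_cont : Continuous fb := by unfold fb; fun_prop

lemma SS_meas : MeasurableSet SS := by
  refine (IsClosed.inter (s₁ := {u : Fin 3 → ℝ | |u 0| ≤ fa (u 2)}) (s₂ := {u : Fin 3 → ℝ | |u 1| ≤ fb (u 2)}) ?_ ?_).measurableSet
  · exact isClosed_le (by fun_prop) (fa_cont.comp (by fun_prop))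
  · exact isClosed_le (by fun_prop) (fb_cont.comp (by fun_prop))

lemma SS_vol : volume SS ≤ ENNReal.ofReal (368 / 3) := by
  have mp := (volume_preserving_piFinSuccAbove (fun _ : Fin 3 => ℝ) 2).symm
  rw [← mp.measure_preimage SS_meas.nullMeasurableSet, Measure.volume_eq_prod,
    Measure.prod_apply (mp.measurable SS_meas)]
  calc _ ≤ ∫⁻ z : ℝ, ((Set.Icc (-3 : ℝ) (-1)).indicator (fun z => ENNReal.ofReal (4 * ((3 + z) * (5 + z)))) z +
    (Set.Icc (-1 : ℝ) 1).indicator (fun z => ENNReal.ofReal (4 * ((3 + z) * (3 - z)))) z +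
    (Set.Icc (1 : ℝ) 3).indicator (fun z => ENNReal.ofReal (4 * ((5 - z) * (3 - z)))) z) := by
        refine lintegral_mono fun z => ?_
        refine le_trans ?_ (sec_vol z)
        have : Prod.mk z ⁻¹' ((MeasurableEquiv.piFinSuccAbove (fun _ : Fin 3 => ℝ) 2).symm ⁻¹' SS) ⊆
            Set.Icc ![-fa z, -fb z] ![fa z, fb z] := by
          rintro u ⟨h1, h2⟩
          have h1 : |u 0| ≤ fa z := h1
          have h2 : |u 1| ≤ fb z := h2
          rw [abs_le] at h1 h2
          constructor <;> intro i <;> fin_cases i <;> simp <;> linarith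
        refine (measure_mono this).trans ?_
        rw [Real.volume_Icc_pi]
        simp only [Fin.prod_univ_two, Matrix.cons_val_zero, Matrix.cons_val_one, sub_neg_eq_add, ← two_mul]
        exact le_rfl
    _ = ENNReal.ofReal (80 / 3) + ENNReal.ofReal (208 / 3) + ENNReal.ofReal (80 / 3) := by
        have m : ∀ (l u : ℝ) (g : ℝ → ℝ), Continuous g →
            Measurable ((Set.Icc l u).indicator (fun z => ENNReal.ofReal (g z))) := fun l u g hg =>
          (hg.measurable.ennreal_ofReal).indicator measurableSet_Icc
        rw [lintegral_add_right _ (m _ _ _ (by fun_prop)), lintegral_add_right _ (m _ _ _ (by fun_prop))]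
        rw [lint_aux (fun z => 4 * ((3 + z) * (5 + z))) (fun z => 4 * (15 * z + 4 * z ^ 2 + z ^ 3 / 3)) _ _ (by norm_num) (by fun_prop)
            (by rintro z ⟨h, h'⟩; have := mul_nonneg (show 0 ≤ 3 + z by linarith) (show 0 ≤ 5 + z by linarith); linarith)
            (by
              intro z
              have := ((((hasDerivAt_id z).const_mul 15).add (((hasDerivAt_id z).pow 2).const_mul 4)).add
                (((hasDerivAt_id z).pow 3).div_const 3)).const_mul 4
              refine (this.congr_deriv ?_)
              simp only [id, Nat.cast_ofNat]; ring),
          lint_aux (fun z => 4 * ((3 + z) * (3 - z))) (fun z => 4 * (9 * z + 0 * z ^ 2 - z ^ 3 / 3)) _ _ (by norm_num) (by fun_prop)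
            (by rintro z ⟨h, h'⟩; have := mul_nonneg (show 0 ≤ 3 + z by linarith) (show 0 ≤ 3 - z by linarith); linarith)
            (by
              intro z
              have := ((((hasDerivAt_id z).const_mul 9).add (((hasDerivAt_id z).pow 2).const_mul 0)).sub
                (((hasDerivAt_id z).pow 3).div_const 3)).const_mul 4
              refine (this.congr_deriv ?_)
              simp only [id, Nat.cast_ofNat]; ring),
          lint_aux (fun z => 4 * ((5 - z) * (3 - z))) (fun z => 4 * (15 * z + (-4) * z ^ 2 + z ^ 3 / 3)) _ _ (by norm_num) (by fun_prop)
            (by rintro z ⟨h, h'⟩; have := mul_nonneg (show 0 ≤ 5 - z by linarith) (show 0 ≤ 3 - z by linarith); linarith)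
            (by
              intro z
              have := ((((hasDerivAt_id z).const_mul 15).add (((hasDerivAt_id z).pow 2).const_mul (-4))).add
                (((hasDerivAt_id z).pow 3).div_const 3)).const_mul 4
              refine (this.congr_deriv ?_)
              simp only [id, Nat.cast_ofNat]; ring)]
        norm_num
    _ ≤ _ := by
        rw [← ENNReal.ofReal_add (by norm_num) (by norm_num), ← ENNReal.ofReal_add (by norm_num) (by norm_num)]
        norm_num

lemma zz_convex : Convex ℝ {x : E3 | |x 0 + x 1| ≤ fa (x 2) ∧ |x 0 - x 1| ≤ fb (x 2)} := by
  intro x hx y hy s t hs ht hst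
  obtain ⟨h1, h2⟩ := hx
  obtain ⟨h3, h4⟩ := hy
  simp only [fa, fb, le_min_iff, abs_le] at h1 h2 h3 h4
  simp only [fa, fb, le_min_iff, abs_le, Set.mem_setOf_eq, PiLp.add_apply, PiLp.smul_apply, smul_eq_mul]
  obtain rfl : s = 1 - t := by linarith
  refine ⟨⟨⟨?_, ?_⟩, ?_, ?_⟩, ⟨?_, ?_⟩, ?_, ?_⟩ <;> nlinarith

lemma TT_vol : volume (convexHull ℝ VS) ≤ ENNReal.ofReal (184 / 3) := by
  have h1 : convexHull ℝ VS ⊆ {x : E3 | |x 0 + x 1| ≤ fa (x 2) ∧ |x 0 - x 1| ≤ fb (x 2)} := by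
    refine VS_tri _ zz_convex ?_
    have key : ∀ a b c : ℝ, |a + b| ≤ fa c ∧ |a - b| ≤ fb c →
      !₂[a, b, c] ∈ {x : E3 | |x 0 + x 1| ≤ fa (x 2) ∧ |x 0 - x 1| ≤ fb (x 2)} := fun _ _ _ h => h
    rintro a b c (⟨rfl, rfl, rfl⟩ | ⟨rfl, rfl, rfl⟩ | ⟨rfl, rfl, rfl⟩) <;>
      refine ⟨key _ _ _ ?_, key _ _ _ ?_, key _ _ _ ?_, key _ _ _ ?_⟩ <;>
      norm_num [fa, fb, abs_le]
  set M : Matrix (Fin 3) (Fin 3) ℝ := !![1, 1, 0; 1, -1, 0; 0, 0, 1] with hM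
  have hdet : M.det = -2 := by rw [hM, Matrix.det_fin_three]; simp; norm_num
  have hdet' : LinearMap.det (Matrix.toLin' M) = -2 := by rw [LinearMap.det_toLin', hdet]
  have h2 : {x : E3 | |x 0 + x 1| ≤ fa (x 2) ∧ |x 0 - x 1| ≤ fb (x 2)} =
      (WithLp.ofLp : E3 → Fin 3 → ℝ) ⁻¹' (Matrix.toLin' M ⁻¹' SS) := by
    ext x
    simp [SS, hM, Matrix.mulVec, dotProduct, Fin.sum_univ_three, sub_eq_add_neg]
  refine (measure_mono h1).trans ?_
  have mm : MeasurableSet (Matrix.toLin' M ⁻¹' SS) :=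
    (LinearMap.continuous_of_finiteDimensional (Matrix.toLin' M)).measurable SS_meas
  rw [h2, (PiLp.volume_preserving_ofLp (Fin 3)).measure_preimage mm.nullMeasurableSet,
    Measure.addHaar_preimage_linearMap _ (by rw [hdet']; norm_num), hdet']
  calc _ ≤ ENNReal.ofReal |(-2 : ℝ)⁻¹| * ENNReal.ofReal (368 / 3) := by gcongr; exact SS_vol
    _ = _ := by rw [← ENNReal.ofReal_mul (by positivity)]; congr 1; norm_num

end vol


end TTP

/-- Every translative packing of the truncated tetrahedron (the convex hull of the 12
points obtained from the coordinate permutations of `(1,1,3)` by applying the sign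
patterns `(+,+,+)`, `(+,−,−)`, `(−,+,−)`, `(−,−,+)`) has upper density at most
`0.7293`. -/
theorem truncated_tetrahedron_translative_packing_bound
    (TT : Set (EuclideanSpace ℝ (Fin 3)))
    (hTT : TT = convexHull ℝ
      {v : EuclideanSpace ℝ (Fin 3) | ∃ (σ : Equiv.Perm (Fin 3)) (ε : Fin 3 → ℝ),
        (ε = ![1, 1, 1] ∨ ε = ![1, -1, -1] ∨ ε = ![-1, 1, -1] ∨ ε = ![-1, -1, 1]) ∧
        v = fun i => ε i * ![1, 1, 3] (σ i)})
    (X : Set (EuclideanSpace ℝ (Fin 3))) (hX : IsTranslativePacking TT X) :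
    packingUpperDensity TT X ≤ 0.7293 := by
  subst hTT
  exact TTP.density_bound _ _ TTP.TT_vol TTP.TT_ball (TTP.packing_ff X hX)
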